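/- Let 1 < p < 2, α ∈ (0,π), s ∈ (0,1), and let f : ℝ → ℝ be continuous with primitive F(t) = ∫₀ᵗ f(τ)dτ, and suppose there exists q > 2p/(2−p) such that t·f(t) ≥ q·F(t) ≥ 0 for all t ∈ ℝ. Then every classical solution u of div(|∇u|^{p−2}∇u) + f(u) = 0 on Ω₂^{α,s} with zero boundary values satisfies 0 ≤ [1 − 2/p + 2/q + (1 + 1/p + 1/q)·s/(1−s)] · ∫_{Ω₂^{α,s}} ‖∇u(x)‖^p dx. -/

import Mathlib

open Real MeasureTheory

noncomputable section

/-- The gradient of a function `u : ℂ → ℝ`, where `ℂ` is identified with `ℝ²`: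
the vector of the two partial derivatives. -/
def grad (u : ℂ → ℝ) (z : ℂ) : ℂ := ⟨fderiv ℝ u z 1, fderiv ℝ u z Complex.I⟩

/-- The divergence of a vector field `A : ℂ → ℂ`, where `ℂ` is identified with `ℝ²`:
`div A = ∂₁A₁ + ∂₂A₂`. -/
def divg (A : ℂ → ℂ) (z : ℂ) : ℝ := (fderiv ℝ A z 1).re + (fderiv ℝ A z Complex.I).im

/-- The domain `Ω₂^{α,s} = {(ρ cos θ, ρ sin θ) : |θ| < α, |ρ - 1| < s} ⊆ ℝ² ≅ ℂ`. -/
def Omega2 (α s : ℝ) : Set ℂ :=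
  {z | ∃ ρ θ : ℝ, |θ| < α ∧ |ρ - 1| < s ∧ z = (ρ : ℂ) * Complex.exp (θ * Complex.I)}

/-- A classical solution of `div(|∇u|^{p-2}∇u) + f(u) = 0` on `Ω` with zero boundary values:
`u` is continuous on the closure of `Ω`, vanishes on the boundary of `Ω`, is continuously
differentiable on `Ω`, the field `A = ‖∇u‖^{p-2}∇u` (equal to `0` where `∇u = 0`, as the
real power `0 ^ (p-2)` is `0` for `p ≠ 2`) is continuously differentiable on `Ω` and satisfies
`div A + f(u) = 0` on `Ω`, and `‖∇u‖^p` is integrable on `Ω`. -/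
structure IsClassicalSolution (p : ℝ) (f : ℝ → ℝ) (Ω : Set ℂ) (u : ℂ → ℝ) : Prop where
  contOn : ContinuousOn u (closure Ω)
  boundary : ∀ z ∈ frontier Ω, u z = 0
  contDiffOn : ContDiffOn ℝ 1 u Ω
  fieldContDiffOn : ContDiffOn ℝ 1 (fun z => (‖grad u z‖ ^ (p - 2) : ℝ) • grad u z) Ω
  pde : ∀ z ∈ Ω, divg (fun w => (‖grad u w‖ ^ (p - 2) : ℝ) • grad u w) z + f (u z) = 0
  integrable : IntegrableOn (fun z => ‖grad u z‖ ^ p) Ω volume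

section

open Set Filter Topology

lemma countable_simple_zeros (g : ℝ → ℝ) (T : Set ℝ)
    (hT : ∀ t ∈ T, g t = 0 ∧ ∃ d, d ≠ 0 ∧ HasDerivAt g d t) : T.Countable := by
  refine (countable_setOfPred_isolated_right_within (s := T)).mono ?_
  intro t ht
  refine ⟨ht, ?_⟩
  obtain ⟨h0, d, hd, hder⟩ := hT t ht
  have h1 := hder.eventually_ne hd (c := 0)
  have h2 : ∀ᶠ z in 𝓝[T ∩ Ioi t] t, g z ≠ 0 := by
    refine h1.filter_mono (nhdsWithin_mono _ ?_)
    rintro x ⟨_, hx⟩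
    exact ne_of_gt hx
  have h3 : ∀ᶠ z in 𝓝[T ∩ Ioi t] t, z ∈ T ∩ Ioi t := self_mem_nhdsWithin
  rw [← empty_mem_iff_bot]
  filter_upwards [h2, h3] with z hz1 hz2
  exact hz1 (hT z hz2.1).1

lemma null_level_dir {U : Set (ℝ × ℝ)} (hU : IsOpen U) {v : ℝ × ℝ → ℝ}
    (hv : ContDiffOn ℝ 1 v U) (e : ℝ × ℝ) :
    MeasurableSet {z | z ∈ U ∧ v z = 0 ∧ fderiv ℝ v z e ≠ 0} := by
  have h1 : IsOpen (U ∩ v ⁻¹' {0}ᶜ) :=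
    hv.continuousOn.isOpen_inter_preimage hU isOpen_compl_singleton
  have hc : ContinuousOn (fun z => fderiv ℝ v z e) U :=
    (hv.continuousOn_fderiv_of_isOpen hU le_rfl).clm_apply continuousOn_const
  have h2 : IsOpen (U ∩ (fun z => fderiv ℝ v z e) ⁻¹' {0}ᶜ) :=
    hc.isOpen_inter_preimage hU isOpen_compl_singleton
  convert h2.measurableSet.diff h1.measurableSet using 1
  ext z
  simp only [mem_ofPred_eq, Set.mem_sdiff, mem_inter_iff, mem_preimage, mem_compl_iff, mem_singleton_iff]
  tauto

lemma null_level {U : Set (ℝ × ℝ)} (hU : IsOpen U) {v : ℝ × ℝ → ℝ}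
    (hv : ContDiffOn ℝ 1 v U) :
    volume {z | z ∈ U ∧ v z = 0 ∧ fderiv ℝ v z ≠ 0} = 0 := by
  have hd : ∀ z ∈ U, HasFDerivAt v (fderiv ℝ v z) z := fun z hz =>
    ((hv.contDiffAt (hU.mem_nhds hz)).differentiableAt (by simp)).hasFDerivAt
  have hA : volume {z | z ∈ U ∧ v z = 0 ∧ fderiv ℝ v z (1, 0) ≠ 0} = 0 := by
    rw [Measure.volume_eq_prod, Measure.prod_apply_symm (null_level_dir hU hv _)]
    refine lintegral_eq_zero_of_ae_eq_zero (Eventually.of_forall fun y => ?_)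
    refine (countable_simple_zeros (fun t => v (t, y)) _ ?_).measure_zero _
    rintro t ⟨h1, h2, h3⟩
    refine ⟨h2, _, h3, ?_⟩
    have : HasDerivAt (fun t : ℝ => (t, y)) ((1, 0) : ℝ × ℝ) t :=
      (hasDerivAt_id t).prodMk (hasDerivAt_const t y)
    exact HasFDerivAt.comp_hasDerivAt t (hd _ h1) this
  have hB : volume {z | z ∈ U ∧ v z = 0 ∧ fderiv ℝ v z (0, 1) ≠ 0} = 0 := by
    rw [Measure.volume_eq_prod, Measure.prod_apply (null_level_dir hU hv _)]
    refine lintegral_eq_zero_of_ae_eq_zero (Eventually.of_forall fun y => ?_)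
    refine (countable_simple_zeros (fun t => v (y, t)) _ ?_).measure_zero _
    rintro t ⟨h1, h2, h3⟩
    refine ⟨h2, _, h3, ?_⟩
    have : HasDerivAt (fun t : ℝ => (y, t)) ((0, 1) : ℝ × ℝ) t :=
      (hasDerivAt_const t y).prodMk (hasDerivAt_id t)
    exact HasFDerivAt.comp_hasDerivAt t (hd _ h1) this
  refine measure_mono_null ?_ (measure_union_null hA hB)
  rintro z ⟨h1, h2, h3⟩
  by_contra hcon
  simp only [mem_union, mem_ofPred_eq, not_or, not_and, not_not] at hcon
  apply h3
  ext
  · simpa using hcon.1 h1 h2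
  · simpa using hcon.2 h1 h2

/-- The truncation profile. -/
lemma exists_trunc : ∃ (Φ : ℝ → ℝ) (C : ℝ), 0 ≤ C ∧ ContDiff ℝ 1 Φ ∧ (∀ t, |t| ≤ 1 → Φ t = 0) ∧
    (∀ t, 2 ≤ |t| → Φ t = t) ∧ (∀ t, |deriv Φ t| ≤ C) ∧ (∀ t, |Φ t| ≤ |t|) := by
  let Φ : ℝ → ℝ := fun t => t * Real.smoothTransition (t ^ 2 - 1)
  have hΦ : ContDiff ℝ 1 Φ :=
    contDiff_id.mul (Real.smoothTransition.contDiff.comp ((contDiff_id.pow 2).sub contDiff_const))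
  have h2 : ∀ t : ℝ, 3 / 2 ≤ |t| → Φ t = t := by
    intro t ht
    have : 1 ≤ t ^ 2 - 1 := by
      rw [← sq_abs]; nlinarith
    simp only [Φ]
    rw [Real.smoothTransition.one_of_one_le this, mul_one]
  have hcd : Continuous (deriv Φ) := hΦ.continuous_deriv le_rfl
  obtain ⟨C, hC⟩ := (isCompact_Icc (a := (-2 : ℝ)) (b := 2)).exists_bound_of_continuousOn hcd.continuousOn
  refine ⟨Φ, max C 1, by positivity, hΦ, ?_, fun t ht => h2 t (by linarith), ?_, ?_⟩
  · intro t ht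
    have : t ^ 2 - 1 ≤ 0 := by
      rw [← sq_abs]; nlinarith [abs_nonneg t]
    simp only [Φ]
    rw [Real.smoothTransition.zero_of_nonpos this, mul_zero]
  · intro t
    by_cases ht : |t| ≤ 2
    · exact (hC t (abs_le.1 ht)).trans (le_max_left _ _)
    · have : Φ =ᶠ[𝓝 t] id := by
        have : ∀ᶠ x in 𝓝 t, 2 < |x| := continuous_abs.continuousAt.eventually (lt_mem_nhds (by simpa using ht))
        filter_upwards [this] with x hx
        exact h2 x (by linarith)
      rw [this.deriv_eq]
      simp
  · intro t
    simp only [Φ, abs_mul]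
    rw [abs_of_nonneg (Real.smoothTransition.nonneg _)]
    exact mul_le_of_le_one_right (abs_nonneg _) (Real.smoothTransition.le_one _)

/-- convexity of `‖·‖^p / p` -/
lemma convex_pow {p : ℝ} (hp : 1 < p) (a b c d : ℝ) (N M : ℝ) (hN : 0 ≤ N) (hM : 0 ≤ M)
    (hNe : N ^ 2 = a ^ 2 + b ^ 2) (hMe : M ^ 2 = c ^ 2 + d ^ 2) :
    N ^ (p - 2) * (a * c + b * d) ≤ (1 - 1 / p) * N ^ p + M ^ p / p := by
  have h1 : a * c + b * d ≤ N * M := by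
    apply le_of_sq_le_sq _ (by positivity) |> fun h => h
    rw [mul_pow, hNe, hMe]
    nlinarith [sq_nonneg (a * d - b * c)]
  have h2 : N ^ (p - 2) * (a * c + b * d) ≤ N ^ (p - 2) * (N * M) :=
    mul_le_mul_of_nonneg_left h1 (by positivity)
  rcases hN.eq_or_lt with rfl | hN'
  · have hM' : 0 ≤ M ^ p / p := by positivity
    have : (0:ℝ) ^ p = 0 := Real.zero_rpow (by linarith)
    rw [this]
    simp at h2 ⊢
    linarith
  · have h3 : N ^ (p - 2) * (N * M) = M * N ^ (p - 1) := by
      rw [show p - 1 = (p - 2) + 1 by ring, Real.rpow_add_one hN'.ne']; ring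
    have hpq := Real.HolderConjugate.conjExponent hp
    have := Real.young_inequality_of_nonneg hM (show 0 ≤ N ^ (p - 1) by positivity) hpq
    have hc : Real.conjExponent p = p / (p - 1) := rfl
    rw [hc, ← Real.rpow_mul hN, show (p - 1) * (p / (p - 1)) = p by
      field_simp [show p - 1 ≠ 0 by linarith]] at this
    have e : N ^ p / (p / (p - 1)) = (1 - 1 / p) * N ^ p := by
      field_simp
    rw [e] at this
    linarith [h2, h3 ▸ this]

end

section

open Set Filter Topology

/-- The open rectangle in coordinates `(ρ - 1, θ)`. -/
def Rect (s α : ℝ) : Set (ℝ × ℝ) := Ioo (-s) s ×ˢ Ioo (-α) α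

lemma isOpen_Rect (s α : ℝ) : IsOpen (Rect s α) := isOpen_Ioo.prod isOpen_Ioo

lemma Rect_bdd (s α : ℝ) : Bornology.IsBounded (Rect s α) :=
  (Metric.isBounded_Ioo _ _).prod (Metric.isBounded_Ioo _ _)

/-- partial derivatives -/
def dx (w : ℝ × ℝ → ℝ) (z : ℝ × ℝ) : ℝ := fderiv ℝ w z (1, 0)
def dy (w : ℝ × ℝ → ℝ) (z : ℝ × ℝ) : ℝ := fderiv ℝ w z (0, 1)

/-- the length of the polar gradient -/
def nrm (w : ℝ × ℝ → ℝ) (z : ℝ × ℝ) : ℝ := √((dx w z) ^ 2 + (dy w z / (1 + z.1)) ^ 2)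

/-- polar inner product -/
def ip (w v : ℝ × ℝ → ℝ) (z : ℝ × ℝ) : ℝ :=
  dx w z * dx v z + dy w z / (1 + z.1) * (dy v z / (1 + z.1))

lemma nrm_nonneg (w : ℝ × ℝ → ℝ) (z : ℝ × ℝ) : 0 ≤ nrm w z := Real.sqrt_nonneg _

lemma nrm_sq (w : ℝ × ℝ → ℝ) (z : ℝ × ℝ) :
    nrm w z ^ 2 = (dx w z) ^ 2 + (dy w z / (1 + z.1)) ^ 2 := Real.sq_sqrt (by positivity)

@[fun_prop] lemma measurable_dx (w : ℝ × ℝ → ℝ) : Measurable (dx w) :=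
  measurable_fderiv_apply_const ℝ w (1, 0)
@[fun_prop] lemma measurable_dy (w : ℝ × ℝ → ℝ) : Measurable (dy w) :=
  measurable_fderiv_apply_const ℝ w (0, 1)
@[fun_prop] lemma measurable_nrm (w : ℝ × ℝ → ℝ) : Measurable (nrm w) := by
  unfold nrm; fun_prop
@[fun_prop] lemma measurable_ip (w v : ℝ × ℝ → ℝ) : Measurable (ip w v) := by
  unfold ip; fun_prop

/-- The weak polar form of the problem. -/
structure Core (p s α : ℝ) (f : ℝ → ℝ) (w : ℝ × ℝ → ℝ) : Prop where
  cont : Continuous w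
  zero : ∀ z ∉ Rect s α, w z = 0
  cd : ContDiffOn ℝ 1 w (Rect s α)
  weak : ∀ φ : ℝ × ℝ → ℝ, ContDiff ℝ 1 φ → HasCompactSupport φ → tsupport φ ⊆ Rect s α →
    ∫ z in Rect s α, (1 + z.1) * (nrm w z ^ (p - 2) * ip w φ z) =
      ∫ z in Rect s α, (1 + z.1) * (f (w z) * φ z)
  int : IntegrableOn (fun z => nrm w z ^ p) (Rect s α)

lemma abs_ip_le {p : ℝ} (hp : 1 < p) (w v : ℝ × ℝ → ℝ) (z : ℝ × ℝ) :
    |nrm w z ^ (p - 2) * ip w v z| ≤ (1 - 1 / p) * nrm w z ^ p + nrm v z ^ p / p := by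
  rw [abs_le]
  constructor
  · have := convex_pow hp (dx w z) (dy w z / (1 + z.1)) (-dx v z) (-(dy v z / (1 + z.1)))
      (nrm w z) (nrm v z) (nrm_nonneg _ _) (nrm_nonneg _ _) (nrm_sq _ _) (by rw [nrm_sq]; ring)
    unfold ip
    linarith
  · exact convex_pow hp (dx w z) (dy w z / (1 + z.1)) (dx v z) ((dy v z / (1 + z.1)))
      (nrm w z) (nrm v z) (nrm_nonneg _ _) (nrm_nonneg _ _) (nrm_sq _ _) (nrm_sq _ _)

/-- properties of truncations -/
lemma trunc_test {U : Set (ℝ × ℝ)} (hU : IsOpen U) (hUb : Bornology.IsBounded U)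
    {v : ℝ × ℝ → ℝ} (hv : Continuous v) (hv0 : ∀ z ∉ U, v z = 0) (hvd : ContDiffOn ℝ 1 v U)
    {Φ : ℝ → ℝ} (hΦ : ContDiff ℝ 1 Φ) (hΦ0 : ∀ t, |t| ≤ 1 → Φ t = 0) {k : ℝ} (hk : 0 < k) :
    ContDiff ℝ 1 (fun z => Φ (k * v z) / k) ∧ HasCompactSupport (fun z => Φ (k * v z) / k) ∧
    tsupport (fun z => Φ (k * v z) / k) ⊆ U ∧
    (∀ z ∈ U, fderiv ℝ (fun z => Φ (k * v z) / k) z = deriv Φ (k * v z) • fderiv ℝ v z) ∧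
    (∀ z ∉ U, fderiv ℝ (fun z => Φ (k * v z) / k) z = 0) := by
  have hts : tsupport (fun z => Φ (k * v z) / k) ⊆ U := by
    have h1 : Function.support (fun z => Φ (k * v z) / k) ⊆ {z | 1 ≤ |k * v z|} := by
      intro z hz
      by_contra hcon
      apply hz
      simp only [mem_ofPred_eq, not_le] at hcon
      simp [hΦ0 _ hcon.le]
    have h2 : IsClosed {z | 1 ≤ |k * v z|} := isClosed_le continuous_const (by fun_prop)
    intro z hz
    have h3 := closure_minimal h1 h2 hz
    by_contra hcon
    simp only [mem_ofPred_eq, hv0 z hcon] at h3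
    norm_num at h3
  have hcs : HasCompactSupport (fun z => Φ (k * v z) / k) :=
    Metric.isCompact_of_isClosed_isBounded (isClosed_tsupport _) (hUb.subset hts)
  have hoff : ∀ z ∉ U, (fun z => Φ (k * v z) / k) =ᶠ[𝓝 z] fun _ => 0 := fun z hz =>
    notMem_tsupport_iff_eventuallyEq.1 (fun h => hz (hts h))
  have hvda : ∀ z ∈ U, ContDiffAt ℝ 1 v z := fun z hz => hvd.contDiffAt (hU.mem_nhds hz)
  refine ⟨?_, hcs, hts, ?_, ?_⟩
  · rw [contDiff_iff_contDiffAt]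
    intro z
    by_cases hz : z ∈ U
    · exact (hΦ.contDiffAt.comp z (contDiffAt_const.mul (hvda z hz))).div_const k
    · exact contDiffAt_const.congr_of_eventuallyEq (hoff z hz)
  · intro z hz
    have h1 := ((hvda z hz).differentiableAt (by simp)).hasFDerivAt
    have h2 := (hΦ.differentiable (by simp) (k * v z)).hasDerivAt
    have h3 := (h2.comp_hasFDerivAt z (h1.const_mul k)).const_mul (k⁻¹)
    have h4 : HasFDerivAt (fun z => Φ (k * v z) / k) (deriv Φ (k * v z) • fderiv ℝ v z) z := by
      convert! h3 using 1
      · ext; simp [div_eq_inv_mul]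
      · ext x <;> simp <;> field_simp
    exact h4.fderiv
  · intro z hz
    rw [(hoff z hz).fderiv_eq]
    simp

lemma trunc_eventually {Φ : ℝ → ℝ} (hΦ2 : ∀ t, 2 ≤ |t| → Φ t = t) {t : ℝ} (ht : t ≠ 0) :
    ∀ᶠ n : ℕ in atTop, Φ ((n + 1 : ℝ) * t) / (n + 1 : ℝ) = t ∧ deriv Φ ((n + 1 : ℝ) * t) = 1 := by
  have h : Tendsto (fun n : ℕ => ((n : ℝ) + 1) * |t|) atTop atTop :=
    (tendsto_natCast_atTop_atTop.atTop_add tendsto_const_nhds).atTop_mul_const (abs_pos.2 ht)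
  filter_upwards [h.eventually_gt_atTop 2] with n hn
  have hn1 : (0 : ℝ) < n + 1 := by positivity
  have h2 : 2 < |((n:ℝ) + 1) * t| := by rwa [abs_mul, abs_of_pos hn1]
  constructor
  · rw [hΦ2 _ h2.le]; field_simp
  · have : Φ =ᶠ[𝓝 (((n:ℝ) + 1) * t)] id := by
      have : ∀ᶠ x in 𝓝 (((n:ℝ) + 1) * t), 2 < |x| :=
        continuous_abs.continuousAt.eventually (lt_mem_nhds h2)
      filter_upwards [this] with x hx
      exact hΦ2 x hx.le
    rw [this.deriv_eq]
    simp

/-- Testing the equation with functions which are merely continuous up to the boundary. -/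
lemma Core.test {p s α : ℝ} {f : ℝ → ℝ} {w : ℝ × ℝ → ℝ} (hw : Core p s α f w)
    (hp : 1 < p) (hs : s ∈ Ioo (0:ℝ) 1) (hf : Continuous f)
    {U : Set (ℝ × ℝ)} (hU : IsOpen U) (hUR : U ⊆ Rect s α)
    {v : ℝ × ℝ → ℝ} (hv : Continuous v) (hv0 : ∀ z ∉ U, v z = 0) (hvd : ContDiffOn ℝ 1 v U)
    (hvi : IntegrableOn (fun z => nrm v z ^ p) U) :
    ∫ z in U, (1 + z.1) * (nrm w z ^ (p - 2) * ip w v z) =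
      ∫ z in Rect s α, (1 + z.1) * (f (w z) * v z) := by
  obtain ⟨Φ, C, hC, hΦ, hΦ0, hΦ2, hΦC, hΦt⟩ := exists_trunc
  have hUb := (Rect_bdd s α).subset hUR
  set φ : ℕ → ℝ × ℝ → ℝ := fun n z => Φ (((n:ℝ) + 1) * v z) / ((n:ℝ) + 1) with hφ
  have key : ∀ n : ℕ, _ := fun n => trunc_test hU hUb hv hv0 hvd hΦ hΦ0 (k := (n:ℝ) + 1) (by positivity)
  have hip : ∀ n, ∀ z ∈ U, ip w (φ n) z = deriv Φ (((n:ℝ) + 1) * v z) * ip w v z := by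
    intro n z hz
    have := (key n).2.2.2.1 z hz
    simp only [ip, dx, dy, hφ, this]
    simp only [_root_.smul_apply, smul_eq_mul]
    ring
  have hip0 : ∀ n, ∀ z ∉ U, ip w (φ n) z = 0 := by
    intro n z hz
    have := (key n).2.2.2.2 z hz
    simp only [ip, dx, dy, hφ, this]
    simp
  have hR : MeasurableSet (Rect s α) := (isOpen_Rect s α).measurableSet
  have eq1 : ∀ n : ℕ, ∫ z in U, (1 + z.1) * (nrm w z ^ (p - 2) * (deriv Φ (((n:ℝ) + 1) * v z) * ip w v z)) =
      ∫ z in Rect s α, (1 + z.1) * (f (w z) * φ n z) := by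
    intro n
    rw [← hw.weak (φ n) (key n).1 (key n).2.1 ((key n).2.2.1.trans hUR)]
    rw [setIntegral_eq_of_subset_of_forall_sdiff_eq_zero hR hUR
      (f := fun z => (1 + z.1) * (nrm w z ^ (p - 2) * ip w (φ n) z))]
    · refine setIntegral_congr_fun hU.measurableSet fun z hz => ?_
      simp only [hip n z hz]
    · intro z hz
      simp [hip0 n z hz.2]
  have hΦm : Measurable (deriv Φ) := (hΦ.continuous_deriv le_rfl).measurable
  have hvm : Measurable v := hv.measurable
  have hwm : Measurable w := hw.cont.measurable
  have hx : ∀ z ∈ Rect s α, |1 + z.1| ≤ 2 := by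
    rintro z ⟨hz, -⟩
    rw [abs_le]; constructor <;> linarith [hz.1, hz.2, hs.1, hs.2]
  have lim1 : Tendsto (fun n : ℕ => ∫ z in U, (1 + z.1) * (nrm w z ^ (p - 2) *
      (deriv Φ (((n:ℝ) + 1) * v z) * ip w v z))) atTop
      (𝓝 (∫ z in U, (1 + z.1) * (nrm w z ^ (p - 2) * ip w v z))) := by
    refine tendsto_integral_of_dominated_convergence
      (fun z => 2 * C * ((1 - 1 / p) * nrm w z ^ p + nrm v z ^ p / p)) ?_ ?_ ?_ ?_
    · intro n
      exact Measurable.aestronglyMeasurable (by fun_prop)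
    · exact (((hw.int.mono_set hUR).const_mul _).add (hvi.div_const _)).const_mul _
    · intro n
      filter_upwards [ae_restrict_mem hU.measurableSet] with z hz
      have h1 := abs_ip_le hp w v z
      have h2 := hΦC (((n:ℝ) + 1) * v z)
      have h3 := hx z (hUR hz)
      calc ‖(1 + z.1) * (nrm w z ^ (p - 2) * (deriv Φ (((n:ℝ) + 1) * v z) * ip w v z))‖
          = |1 + z.1| * |deriv Φ (((n:ℝ) + 1) * v z)| * |nrm w z ^ (p - 2) * ip w v z| := by
            rw [Real.norm_eq_abs]; simp only [abs_mul]; ring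
        _ ≤ 2 * C * ((1 - 1 / p) * nrm w z ^ p + nrm v z ^ p / p) := by gcongr
    · have hnull : ∀ᵐ z ∂(volume.restrict U), ¬ (z ∈ U ∧ v z = 0 ∧ fderiv ℝ v z ≠ 0) :=
        ae_restrict_of_ae (measure_eq_zero_iff_ae_notMem.1 (null_level hU hvd))
      filter_upwards [ae_restrict_mem hU.measurableSet, hnull] with z hz hzn
      by_cases h0 : v z = 0
      · have hfd : fderiv ℝ v z = 0 := by
          by_contra h; exact hzn ⟨hz, h0, h⟩
        have : ip w v z = 0 := by simp [ip, dx, dy, hfd]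
        simp [this]
      · refine tendsto_const_nhds.congr' ?_
        filter_upwards [trunc_eventually hΦ2 h0] with n hn
        rw [hn.2, one_mul]
  obtain ⟨Kv, hKv⟩ : ∃ K, ∀ z ∈ Rect s α, |f (w z) * v z| ≤ K := by
    have hc : IsCompact (closure (Rect s α)) := (Rect_bdd s α).isCompact_closure
    obtain ⟨K, hK⟩ := hc.exists_bound_of_continuousOn (f := fun z => f (w z) * v z)
      (((hf.comp hw.cont).mul hv).continuousOn)
    exact ⟨K, fun z hz => hK z (subset_closure hz)⟩
  have lim2 : Tendsto (fun n : ℕ => ∫ z in Rect s α, (1 + z.1) * (f (w z) * φ n z)) atTop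
      (𝓝 (∫ z in Rect s α, (1 + z.1) * (f (w z) * v z))) := by
    refine tendsto_integral_of_dominated_convergence (fun z => 2 * Kv) ?_ ?_ ?_ ?_
    · intro n
      have : Continuous (φ n) := (key n).1.continuous
      have : Continuous (fun z : ℝ × ℝ => (1 + z.1) * (f (w z) * φ n z)) := by
        have := hw.cont
        fun_prop
      exact this.aestronglyMeasurable
    · exact integrableOn_const (Rect_bdd s α).measure_lt_top.ne
    · intro n
      filter_upwards [ae_restrict_mem hR] with z hz
      have h1 := hKv z hz
      have h3 := hx z hz
      have hn1 : (0 : ℝ) < n + 1 := by positivity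
      have h4 : |φ n z| ≤ |v z| := by
        simp only [hφ]
        rw [abs_div, abs_of_pos hn1, div_le_iff₀ hn1]
        refine (hΦt _).trans (le_of_eq ?_)
        rw [abs_mul, abs_of_pos hn1, mul_comm]
      calc ‖(1 + z.1) * (f (w z) * φ n z)‖ = |1 + z.1| * (|f (w z)| * |φ n z|) := by
            rw [Real.norm_eq_abs]; simp only [abs_mul]
        _ ≤ |1 + z.1| * (|f (w z)| * |v z|) := by gcongr
        _ ≤ 2 * Kv := by rw [← abs_mul]; gcongr
    · filter_upwards with z
      by_cases h0 : v z = 0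
      · have : ∀ n, φ n z = 0 := fun n => by simp [hφ, h0, hΦ0]
        simp [this, h0]
      · refine tendsto_const_nhds.congr' ?_
        filter_upwards [trunc_eventually hΦ2 h0] with n hn
        simp only [hφ]
        rw [hn.1]
  simp_rw [eq1] at lim1
  exact tendsto_nhds_unique lim1 lim2

end

section

open Set Filter Topology

lemma lintegral_scale_le {h : ℝ × ℝ → ENNReal} (hh : Measurable h) {μ : ℝ} (hμ : 1 ≤ μ) :
    ∫⁻ z, h (μ • z) ≤ ∫⁻ z, h z := by
  have h1 : ∫⁻ z, h (μ • z) = ∫⁻ z, h z ∂(Measure.map (fun z : ℝ × ℝ => μ • z) volume) := by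
    rw [lintegral_map hh (by fun_prop)]
  rw [h1, Measure.map_addHaar_smul _ (by linarith), lintegral_smul_measure]
  refine mul_le_of_le_one_left zero_le ?_
  rw [ENNReal.ofReal_le_one, abs_of_pos (by positivity)]
  exact inv_le_one_of_one_le₀ (one_le_pow₀ hμ)

lemma scale_L1 {v : ℝ × ℝ → ℝ} (hv : ContDiff ℝ 1 v) {l : ℝ} (hl : 1 ≤ l) :
    ∫⁻ z, ‖v (l • z) - v z‖ₑ ≤ ENNReal.ofReal (l - 1) * ∫⁻ z, ‖fderiv ℝ v z z‖ₑ := by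
  have hcf : Continuous (fderiv ℝ v) := hv.continuous_fderiv (by simp)
  have hpt : ∀ z, ‖v (l • z) - v z‖ₑ ≤ ∫⁻ t in Ioc 1 l, ‖fderiv ℝ v (t • z) (t • z)‖ₑ := by
    intro z
    have hd : ∀ t ∈ uIcc 1 l, HasDerivAt (fun t : ℝ => v (t • z)) (fderiv ℝ v (t • z) z) t := by
      intro t _
      have h1 := (hv.differentiable (by simp) (t • z)).hasFDerivAt
      have h2 : HasDerivAt (fun t : ℝ => t • z) z t := by
        simpa using (hasDerivAt_id t).smul_const z
      exact h1.comp_hasDerivAt t h2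
    have hci : Continuous (fun t : ℝ => fderiv ℝ v (t • z) z) := by fun_prop
    have h3 := intervalIntegral.integral_eq_sub_of_hasDerivAt hd (hci.intervalIntegrable _ _)
    rw [one_smul] at h3
    rw [← h3, intervalIntegral.integral_of_le hl]
    refine (enorm_integral_le_lintegral_enorm _).trans ?_
    refine setLIntegral_mono' measurableSet_Ioc fun t ht => ?_
    rw [map_smul, enorm_smul]
    refine le_mul_of_one_le_left zero_le ?_
    rw [Real.enorm_eq_ofReal (by linarith [ht.1])]
    exact ENNReal.one_le_ofReal.2 ht.1.le
  calc ∫⁻ z, ‖v (l • z) - v z‖ₑ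
      ≤ ∫⁻ z, ∫⁻ t in Ioc 1 l, ‖fderiv ℝ v (t • z) (t • z)‖ₑ := lintegral_mono hpt
    _ = ∫⁻ t in Ioc 1 l, ∫⁻ z, ‖fderiv ℝ v (t • z) (t • z)‖ₑ := by
        refine lintegral_lintegral_swap ?_
        have : Continuous (Function.uncurry fun (z : ℝ × ℝ) (t : ℝ) =>
            ‖fderiv ℝ v (t • z) (t • z)‖ₑ) := by
          simp only [Function.uncurry_def]
          refine Continuous.enorm ?_
          fun_prop
        exact this.measurable.aemeasurable
    _ ≤ ∫⁻ t in Ioc 1 l, ∫⁻ z, ‖fderiv ℝ v z z‖ₑ := by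
        refine setLIntegral_mono' measurableSet_Ioc fun t ht => ?_
        refine lintegral_scale_le (h := fun z => ‖fderiv ℝ v z z‖ₑ) ?_ ht.1.le
        have : Continuous (fun z => ‖fderiv ℝ v z z‖ₑ) := by
          refine Continuous.enorm ?_
          fun_prop
        exact this.measurable
    _ = ENNReal.ofReal (l - 1) * ∫⁻ z, ‖fderiv ℝ v z z‖ₑ := by
        rw [setLIntegral_const, Real.volume_Ioc, mul_comm]

lemma fderiv_self (w : ℝ × ℝ → ℝ) (z : ℝ × ℝ) :
    fderiv ℝ w z z = z.1 * dx w z + z.2 * dy w z := by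
  have : z = z.1 • ((1, 0) : ℝ × ℝ) + z.2 • ((0, 1) : ℝ × ℝ) := by ext <;> simp
  conv_lhs => rw [this]
  rw [map_add, map_smul, map_smul, ← this]
  rfl

lemma abs_dx_le (w : ℝ × ℝ → ℝ) (z : ℝ × ℝ) : |dx w z| ≤ nrm w z := by
  apply Real.abs_le_sqrt; nlinarith [sq_nonneg (dy w z / (1 + z.1))]

lemma abs_dy_le (w : ℝ × ℝ → ℝ) (z : ℝ × ℝ) : |dy w z / (1 + z.1)| ≤ nrm w z := by
  apply Real.abs_le_sqrt; nlinarith [sq_nonneg (dx w z)]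

lemma fderiv_self_le {s α : ℝ} (hs : s ∈ Ioo (0:ℝ) 1) (w : ℝ × ℝ → ℝ)
    {z : ℝ × ℝ} (hz : z ∈ Rect s α) : |fderiv ℝ w z z| ≤ (1 + 2 * α) * nrm w z := by
  rw [fderiv_self]
  have h1 := abs_dx_le w z
  have h2 := abs_dy_le w z
  obtain ⟨⟨a1, a2⟩, ⟨a3, a4⟩⟩ := hz
  obtain ⟨b1, b2⟩ := hs
  have hm : 0 < 1 + z.1 := by linarith
  have h3 : |dy w z| ≤ 2 * nrm w z := by
    rw [abs_div, abs_of_pos hm, div_le_iff₀ hm] at h2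
    nlinarith [nrm_nonneg w z]
  have h4 : |z.1| ≤ 1 := by rw [abs_le]; constructor <;> linarith
  have h5 : |z.2| ≤ α := by rw [abs_le]; constructor <;> linarith
  calc _ ≤ |z.1| * |dx w z| + |z.2| * |dy w z| := by
        rw [← abs_mul, ← abs_mul]; exact abs_add_le _ _
    _ ≤ 1 * nrm w z + α * (2 * nrm w z) := by
        have : 0 ≤ α := (abs_nonneg _).trans h5
        gcongr
    _ = _ := by ring

lemma Core.compactSupport {p s α : ℝ} {f : ℝ → ℝ} {w : ℝ × ℝ → ℝ} (hw : Core p s α f w) :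
    HasCompactSupport w := by
  refine HasCompactSupport.of_support_subset_isCompact (K := closure (Rect s α))
    (Rect_bdd s α).isCompact_closure ?_
  intro z hz
  by_contra h
  exact hz (hw.zero z fun h' => h (subset_closure h'))

lemma Core.L1 {p s α : ℝ} {f : ℝ → ℝ} {w : ℝ × ℝ → ℝ} (hw : Core p s α f w)
    (hp : 1 < p) (hs : s ∈ Ioo (0:ℝ) 1) :
    ∃ K : ℝ, 0 ≤ K ∧ ∀ l : ℝ, 1 ≤ l → ∫ z, |w (l • z) - w z| ≤ K * (l - 1) := by
  obtain ⟨Φ, C, hC, hΦ, hΦ0, hΦ2, hΦC, hΦt⟩ := exists_trunc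
  set φ : ℕ → ℝ × ℝ → ℝ := fun n z => Φ (((n:ℝ) + 1) * w z) / ((n:ℝ) + 1) with hφ
  have key : ∀ n : ℕ, _ := fun n => trunc_test (isOpen_Rect s α) (Rect_bdd s α) hw.cont hw.zero
    hw.cd hΦ hΦ0 (k := (n:ℝ) + 1) (by positivity)
  have hR : MeasurableSet (Rect s α) := (isOpen_Rect s α).measurableSet
  set M : ENNReal := ∫⁻ z in Rect s α, ‖C * ((1 + 2 * α) * (1 + nrm w z ^ p))‖ₑ with hM
  have hMt : M < ⊤ := by
    have : IntegrableOn (fun z => C * ((1 + 2 * α) * (1 + nrm w z ^ p))) (Rect s α) :=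
      (((integrableOn_const (Rect_bdd s α).measure_lt_top.ne).add hw.int).const_mul _).const_mul _
    exact this.2
  have hb : ∀ n, ∫⁻ z, ‖fderiv ℝ (φ n) z z‖ₑ ≤ M := by
    intro n
    rw [hM, ← lintegral_indicator hR]
    refine lintegral_mono fun z => ?_
    by_cases hz : z ∈ Rect s α
    · rw [indicator_of_mem hz]
      refine enorm_le_iff_norm_le.2 ?_
      have h0 := (key n).2.2.2.1 z hz
      have h1 := hΦC (((n:ℝ) + 1) * w z)
      have h2 := fderiv_self_le hs w hz
      have hα : 0 ≤ 1 + 2 * α := by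
        have := hz.2.1.trans hz.2.2
        linarith
      have h3 : nrm w z ≤ 1 + nrm w z ^ p := by
        rcases le_total (nrm w z) 1 with h | h
        · have := Real.rpow_nonneg (nrm_nonneg w z) p
          linarith
        · have := Real.self_le_rpow_of_one_le h hp.le
          linarith
      calc ‖fderiv ℝ (φ n) z z‖ = |deriv Φ (((n:ℝ) + 1) * w z)| * |fderiv ℝ w z z| := by
            simp only [hφ]; rw [h0, _root_.smul_apply, smul_eq_mul, norm_mul]; rfl
        _ ≤ C * ((1 + 2 * α) * nrm w z) := by gcongr
        _ ≤ C * ((1 + 2 * α) * (1 + nrm w z ^ p)) := by gcongr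
        _ ≤ _ := le_abs_self _
    · have h0 := (key n).2.2.2.2 z hz
      simp only [hφ]
      rw [h0]
      simp
  refine ⟨M.toReal, ENNReal.toReal_nonneg, fun l hl => ?_⟩
  have hmain : ∫⁻ z, ‖w (l • z) - w z‖ₑ ≤ ENNReal.ofReal (l - 1) * M := by
    have hcw := hw.cont
    have hpt : ∀ z, Tendsto (fun n => φ n z) atTop (𝓝 (w z)) := by
      intro z
      by_cases h0 : w z = 0
      · have : ∀ n, φ n z = 0 := fun n => by simp [hφ, h0, hΦ0]
        simp [this, h0]
      · refine tendsto_const_nhds.congr' ?_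
        filter_upwards [trunc_eventually hΦ2 h0] with n hn
        simp only [hφ]
        rw [hn.1]
    calc ∫⁻ z, ‖w (l • z) - w z‖ₑ = ∫⁻ z, liminf (fun n => ‖φ n (l • z) - φ n z‖ₑ) atTop := by
          refine lintegral_congr fun z => ?_
          exact (((hpt (l • z)).sub (hpt z)).enorm).liminf_eq.symm
      _ ≤ liminf (fun n => ∫⁻ z, ‖φ n (l • z) - φ n z‖ₑ) atTop := by
          refine lintegral_liminf_le fun n => ?_
          have := (key n).1.continuous
          have h2 : Continuous (fun z => ‖φ n (l • z) - φ n z‖ₑ) := by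
            refine Continuous.enorm ?_
            have h3 : Continuous (φ n) := this
            fun_prop
          exact h2.measurable
      _ ≤ ENNReal.ofReal (l - 1) * M := by
          refine liminf_le_of_frequently_le' (Frequently.of_forall fun n => ?_)
          refine (scale_L1 (key n).1 hl).trans ?_
          gcongr
          exact hb n
  have e : ∫ z, |w (l • z) - w z| = (∫⁻ z, ‖w (l • z) - w z‖ₑ).toReal := by
    have := hw.cont
    rw [← integral_norm_eq_lintegral_enorm]
    · rfl
    · exact Continuous.aestronglyMeasurable (by fun_prop)
  rw [e, mul_comm, ← ENNReal.toReal_ofReal (show 0 ≤ l - 1 by linarith), ← ENNReal.toReal_mul]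
  exact ENNReal.toReal_mono (ENNReal.mul_ne_top ENNReal.ofReal_ne_top hMt.ne) hmain

end

section

open Set Filter Topology

lemma deriv_nonneg_of_right_min {D : ℝ → ℝ} {d : ℝ} (hD : HasDerivAt D d 1)
    (h : ∀ᶠ l in 𝓝[>] (1:ℝ), D 1 ≤ D l) : 0 ≤ d := by
  have h1 := hD.hasDerivWithinAt (s := Ioi 1)
  rw [hasDerivWithinAt_iff_tendsto_slope' (by simp)] at h1
  refine ge_of_tendsto h1 ?_
  filter_upwards [h, self_mem_nhdsWithin] with l hl hl1
  rw [slope_def_field]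
  exact div_nonneg (by linarith) (by linarith [show (1:ℝ) < l from hl1])

lemma numeric_limit {p S I J E : ℝ} (hp : 1 < p)
    (h : ∀ᶠ l in 𝓝[>] (1:ℝ), (l ^ 2)⁻¹ * (1 + (l - 1) * S)⁻¹ * J - J - E * (l - 1) ≤
      (l ^ 2)⁻¹ * (l ^ p * (1 + (l - 1) * S) ^ p) * I / p - I / p) :
    0 ≤ (1 - 2 / p + S) * I + (2 + S) * J + E := by
  set D : ℝ → ℝ := fun l => (l ^ 2)⁻¹ * (l ^ p * (1 + (l - 1) * S) ^ p) * I / p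
    - (l ^ 2)⁻¹ * (1 + (l - 1) * S)⁻¹ * J + E * (l - 1) with hD
  have e1 : HasDerivAt (fun l : ℝ => (l ^ 2)⁻¹) (-2) 1 := by
    have := ((hasDerivAt_id (1:ℝ)).pow 2).inv (by norm_num)
    convert! this using 1
    norm_num
  have e2 : HasDerivAt (fun l : ℝ => 1 + (l - 1) * S) S 1 := by
    have := (((hasDerivAt_id (1:ℝ)).sub_const 1).mul_const S).const_add 1
    simpa using this
  have e3 : HasDerivAt (fun l : ℝ => (1 + (l - 1) * S)⁻¹) (-S) 1 := by
    have := e2.inv (by norm_num)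
    convert! this using 1
    norm_num
  have e4 : HasDerivAt (fun l : ℝ => l ^ p) p 1 := by
    have := Real.hasDerivAt_rpow_const (x := 1) (p := p) (Or.inl one_ne_zero)
    simpa using this
  have e5 : HasDerivAt (fun l : ℝ => (1 + (l - 1) * S) ^ p) (S * p) 1 := by
    have := e2.rpow_const (p := p) (Or.inl (by norm_num))
    simpa using this
  have e6 : HasDerivAt D ((-2 * (1 * 1) + 1 * (p * 1 + 1 * (S * p))) * I / p
      - (-2 * 1 + 1 * (-S)) * J + E * 1) 1 := by
    have := ((((e1.mul (e4.mul e5)).mul_const I).div_const p).sub ((e1.mul e3).mul_const J)).add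
      (((hasDerivAt_id (1:ℝ)).sub_const 1).const_mul E)
    convert! this using 1
    simp
  have h0 := deriv_nonneg_of_right_min e6 (by
    filter_upwards [h] with l hl
    simp only [hD]
    simp
    linarith)
  have : (-2 * (1 * 1) + 1 * (p * 1 + 1 * (S * p))) * I / p
      - (-2 * 1 + 1 * (-S)) * J + E * 1 = (1 - 2 / p + S) * I + (2 + S) * J + E := by
    field_simp
    ring
  linarith

lemma taylor_le {f F : ℝ → ℝ} (hF : ∀ t, HasDerivAt F (f t) t) {B ε δ : ℝ}
    (hδ : ∀ a ∈ Icc (-B) B, ∀ b ∈ Icc (-B) B, |a - b| < δ → |f a - f b| ≤ ε)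
    {a b : ℝ} (ha : a ∈ Icc (-B) B) (hb : b ∈ Icc (-B) B) (hab : |b - a| < δ) :
    |F b - F a - f a * (b - a)| ≤ ε * |b - a| := by
  have hd : ∀ t ∈ uIcc a b, HasDerivWithinAt (fun t => F t - f a * t) (f t - f a) (uIcc a b) t := by
    intro t _
    have := (hF t).sub ((hasDerivAt_id t).const_mul (f a))
    rw [mul_one] at this
    exact this.hasDerivWithinAt
  have hbd : ∀ t ∈ uIcc a b, ‖f t - f a‖ ≤ ε := by
    intro t ht
    have h1 : t ∈ Icc (-B) B := (convex_Icc (-B) B).ordConnected.uIcc_subset ha hb ht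
    refine hδ t h1 a ha (lt_of_le_of_lt ?_ hab)
    exact abs_sub_left_of_mem_uIcc ht
  have := (convex_uIcc a b).norm_image_sub_le_of_norm_hasDerivWithin_le hd hbd left_mem_uIcc right_mem_uIcc
  simp only [Real.norm_eq_abs] at this
  refine le_trans (le_of_eq ?_) this
  congr 1
  ring

lemma Core.taylor {p s α : ℝ} {f F : ℝ → ℝ} {w : ℝ × ℝ → ℝ} (hw : Core p s α f w)
    (hf : Continuous f) (hF : ∀ t, HasDerivAt F (f t) t) {ε : ℝ} (hε : 0 < ε) :
    ∀ᶠ l in 𝓝[>] (1:ℝ), ∀ z ∈ Rect s α,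
      |F (w (l • z)) - F (w z) - f (w z) * (w (l • z) - w z)| ≤ ε * |w (l • z) - w z| := by
  obtain ⟨B, hB⟩ := hw.compactSupport.exists_bound_of_continuous hw.cont
  have huf := (isCompact_Icc (a := -B) (b := B)).uniformContinuousOn_of_continuous hf.continuousOn
  rw [Metric.uniformContinuousOn_iff_le] at huf
  obtain ⟨δ, hδ, hδf⟩ := huf ε hε
  have huw := hw.compactSupport.uniformContinuous_of_continuous hw.cont
  rw [Metric.uniformContinuous_iff] at huw
  obtain ⟨η, hη, hηw⟩ := huw δ hδ
  obtain ⟨D, hD0, hD⟩ := (Rect_bdd s α).exists_pos_norm_le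
  have : ∀ᶠ l in 𝓝[>] (1:ℝ), l < 1 + η / D :=
    mem_nhdsWithin_of_mem_nhds (gt_mem_nhds (by linarith [div_pos hη hD0]))
  filter_upwards [this, self_mem_nhdsWithin] with l hl hl1 z hz
  have hl1 : 1 < l := hl1
  have hwB : ∀ z, w z ∈ Icc (-B) B := fun z => abs_le.1 (hB z)
  refine taylor_le hF (B := B) (δ := δ) ?_ (hwB _) (hwB _) ?_
  · intro a ha b hb hab
    exact hδf a ha b hb hab.le
  · refine hηw ?_
    rw [dist_eq_norm, show l • z - z = (l - 1) • z by rw [sub_smul, one_smul], norm_smul,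
      Real.norm_of_nonneg (by linarith)]
    calc (l - 1) * ‖z‖ ≤ (l - 1) * D := mul_le_mul_of_nonneg_left (hD z hz) (by linarith)
      _ < η / D * D := by gcongr; linarith
      _ = η := by field_simp

lemma geom1 {s x l : ℝ} (hs : s ∈ Ioo (0:ℝ) 1) (hl : 1 < l) (h1 : -s < l * x) (h2 : l * x < s) :
    1 + l * x ≤ (1 + (l - 1) * (s / (1 - s))) * (1 + x) ∧ 0 < 1 + x ∧ 0 < 1 + l * x := by
  obtain ⟨s0, s1⟩ := hs
  have hl0 : 0 < l := by linarith
  have hx1 : -s < x := by nlinarith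
  have hx2 : x < s := by nlinarith
  have hS : s ≤ s / (1 - s) := by rw [le_div_iff₀ (by linarith)]; nlinarith
  refine ⟨?_, by linarith, by linarith⟩
  rcases le_total 0 x with h | h
  · have : x ≤ s / (1 - s) * (1 + x) := by nlinarith
    nlinarith
  · have : x ≤ s / (1 - s) * (1 + x) := h.trans (mul_nonneg (by linarith) (by linarith))
    nlinarith

lemma geom2 {s x l : ℝ} (hs : s ∈ Ioo (0:ℝ) 1) (hl : 1 < l) (h1 : -s < l * x) (h2 : x < 0) :
    1 + x ≤ (1 + (l - 1) * (s / (1 - s))) * (1 + l * x) := by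
  obtain ⟨s0, s1⟩ := hs
  have hl0 : 0 < l := by linarith
  have h3 : s / (1 - s) * (1 + l * x) ≥ s / (1 - s) * (1 - s) :=
    mul_le_mul_of_nonneg_left (by linarith) (div_nonneg s0.le (by linarith))
  rw [div_mul_cancel₀ _ (by linarith)] at h3
  have h4 : -s ≤ x := by nlinarith
  nlinarith [mul_nonneg (show 0 ≤ l - 1 by linarith) (show 0 ≤ x + s by linarith),
    mul_le_mul_of_nonneg_left h3 (show 0 ≤ l - 1 by linarith)]

/-- pointwise gradient comparison -/
lemma grad_compare {p x l a b τ M N : ℝ} (hp : 1 < p) (hl : 1 < l) (hτ : 1 ≤ τ)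
    (hx : 0 < 1 + x) (hlx : 0 < 1 + l * x)
    (g1 : 1 + l * x ≤ τ * (1 + x)) (g2 : x < 0 → 1 + x ≤ τ * (1 + l * x))
    (hM : 0 ≤ M) (hN : 0 ≤ N)
    (hMe : M ^ 2 = (l * a) ^ 2 + (l * b / (1 + x)) ^ 2)
    (hNe : N ^ 2 = a ^ 2 + (b / (1 + l * x)) ^ 2) :
    (1 + x) * M ^ p ≤ l ^ p * τ ^ p * ((1 + l * x) * N ^ p) := by
  have hl0 : 0 < l := by linarith
  have hτ0 : 0 < τ := by linarith
  rcases le_or_gt 0 x with h | h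
  · have h1 : M ≤ l * τ * N := by
      refine le_of_sq_le_sq ?_ (by positivity)
      rw [mul_pow, mul_pow, hMe, hNe]
      have h2 : (b / (1 + x)) ^ 2 ≤ τ ^ 2 * (b / (1 + l * x)) ^ 2 := by
        rw [← mul_pow]
        refine sq_le_sq.2 ?_
        rw [abs_div, abs_mul, abs_div, abs_of_pos hx, abs_of_pos hlx, abs_of_pos hτ0,
          ← mul_div_assoc, div_le_div_iff₀ hx hlx]
        nlinarith [mul_le_mul_of_nonneg_left g1 (abs_nonneg b)]
      have h3 : a ^ 2 ≤ τ ^ 2 * a ^ 2 := le_mul_of_one_le_left (sq_nonneg _) (one_le_pow₀ hτ)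
      calc (l * a) ^ 2 + (l * b / (1 + x)) ^ 2 = l ^ 2 * (a ^ 2 + (b / (1 + x)) ^ 2) := by ring
        _ ≤ l ^ 2 * (τ ^ 2 * a ^ 2 + τ ^ 2 * (b / (1 + l * x)) ^ 2) := by gcongr
        _ = _ := by ring
    have h4 : M ^ p ≤ l ^ p * τ ^ p * N ^ p := by
      rw [← Real.mul_rpow hl0.le hτ0.le, ← Real.mul_rpow (by positivity) hN]
      exact Real.rpow_le_rpow hM h1 (by linarith)
    calc (1 + x) * M ^ p ≤ (1 + l * x) * (l ^ p * τ ^ p * N ^ p) := by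
          gcongr; nlinarith
      _ = _ := by ring
  · have h1 : M ≤ l * N := by
      refine le_of_sq_le_sq ?_ (by positivity)
      rw [mul_pow, hMe, hNe]
      have h2 : (b / (1 + x)) ^ 2 ≤ (b / (1 + l * x)) ^ 2 := by
        refine sq_le_sq.2 ?_
        rw [abs_div, abs_div, abs_of_pos hx, abs_of_pos hlx]
        gcongr
        nlinarith
      calc (l * a) ^ 2 + (l * b / (1 + x)) ^ 2 = l ^ 2 * (a ^ 2 + (b / (1 + x)) ^ 2) := by ring
        _ ≤ l ^ 2 * (a ^ 2 + (b / (1 + l * x)) ^ 2) := by gcongr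
    have h4 : M ^ p ≤ l ^ p * N ^ p := by
      rw [← Real.mul_rpow hl0.le hN]
      exact Real.rpow_le_rpow hM h1 (by linarith)
    have h5 : τ ≤ τ ^ p := Real.self_le_rpow_of_one_le hτ hp.le
    calc (1 + x) * M ^ p ≤ (τ ^ p * (1 + l * x)) * (l ^ p * N ^ p) := by
          gcongr
          exact (g2 h).trans (by gcongr)
      _ = _ := by ring

end

section

open Set Filter Topology Pointwise

lemma ip_self {p : ℝ} (hp : 1 < p) (w : ℝ × ℝ → ℝ) (z : ℝ × ℝ) :
    nrm w z ^ (p - 2) * ip w w z = nrm w z ^ p := by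
  have h : ip w w z = nrm w z ^ 2 := by rw [nrm_sq]; unfold ip; ring
  rw [h]
  rcases (nrm_nonneg w z).eq_or_lt with h0 | h0
  · rw [← h0, Real.zero_rpow (by linarith : p ≠ 0)]; simp
  · rw [← Real.rpow_natCast, ← Real.rpow_add h0]; norm_num

section
variable {p s α : ℝ} {f F : ℝ → ℝ} {w : ℝ × ℝ → ℝ}

lemma mem_scale_Rect {l : ℝ} (hl : 1 < l) {z : ℝ × ℝ} (hz : l • z ∈ Rect s α) : z ∈ Rect s α := by
  obtain ⟨⟨h1, h2⟩, ⟨h3, h4⟩⟩ := hz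
  simp only [Prod.smul_fst, Prod.smul_snd, smul_eq_mul] at h1 h2 h3 h4
  refine ⟨⟨?_, ?_⟩, ⟨?_, ?_⟩⟩ <;> nlinarith

lemma Core.scaled_deriv (hw : Core p s α f w) {l : ℝ} {z : ℝ × ℝ} (hz : l • z ∈ Rect s α) :
    dx (fun z => w (l • z)) z = l * dx w (l • z) ∧ dy (fun z => w (l • z)) z = l * dy w (l • z) := by
  have h1 := ((hw.cd.contDiffAt ((isOpen_Rect s α).mem_nhds hz)).differentiableAt
    (by simp)).hasFDerivAt
  have h2 : HasFDerivAt (fun z : ℝ × ℝ => l • z) (l • ContinuousLinearMap.id ℝ (ℝ × ℝ)) z :=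
    (hasFDerivAt_id z).const_smul l
  have h3 := (HasFDerivAt.comp z h1 h2).fderiv
  have h4 : fderiv ℝ (fun z => w (l • z)) z = (fderiv ℝ w (l • z)).comp
    (l • ContinuousLinearMap.id ℝ (ℝ × ℝ)) := h3
  constructor
  · simp only [dx, h4]
    rw [ContinuousLinearMap.comp_apply, _root_.smul_apply, map_smul]; rfl
  · simp only [dy, h4]
    rw [ContinuousLinearMap.comp_apply, _root_.smul_apply, map_smul]; rfl

lemma Core.int_weight (hw : Core p s α f w) (hs : s ∈ Ioo (0:ℝ) 1) :
    IntegrableOn (fun z => (1 + z.1) * nrm w z ^ p) (Rect s α) := by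
  refine Integrable.mono' (hw.int.const_mul 2) (Measurable.aestronglyMeasurable (by fun_prop)) ?_
  filter_upwards [ae_restrict_mem (isOpen_Rect s α).measurableSet] with z hz
  have h := Real.rpow_nonneg (nrm_nonneg w z) p
  have h2 : |1 + z.1| ≤ 2 := by
    rw [abs_le]; constructor <;> linarith [hz.1.1, hz.1.2, hs.1, hs.2]
  rw [norm_mul, Real.norm_eq_abs, Real.norm_of_nonneg h]
  gcongr

lemma intOn_cont {g : ℝ × ℝ → ℝ} (hg : Continuous g) : IntegrableOn g (Rect s α) :=
  (hg.continuousOn.integrableOn_compact (Rect_bdd s α).isCompact_closure).mono_set subset_closure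

lemma setIntegral_scale {l : ℝ} (hl : 1 < l) (h : ℝ × ℝ → ℝ) :
    ∫ z in {z | l • z ∈ Rect s α}, h (l • z) = (l ^ 2)⁻¹ * ∫ z in Rect s α, h z := by
  rw [Measure.setIntegral_comp_smul_of_pos _ h _ (by linarith)]
  have : l • {z | l • z ∈ Rect s α} = Rect s α := by
    ext z
    rw [mem_smul_set_iff_inv_smul_mem₀ (by linarith : l ≠ 0)]
    simp only [mem_ofPred_eq]
    rw [smul_inv_smul₀ (by linarith : l ≠ 0)]
  rw [this]
  simp

lemma Core.energy (hw : Core p s α f w) (hp : 1 < p) (hs : s ∈ Ioo (0:ℝ) 1) (hf : Continuous f) :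
    ∫ z in Rect s α, (1 + z.1) * nrm w z ^ p = ∫ z in Rect s α, (1 + z.1) * (f (w z) * w z) := by
  rw [← hw.test hp hs hf (isOpen_Rect s α) subset_rfl hw.cont hw.zero hw.cd hw.int]
  simp_rw [ip_self hp]

lemma Core.step (hw : Core p s α f w) (hp : 1 < p) (hs : s ∈ Ioo (0:ℝ) 1) (hf : Continuous f)
    (hF : ∀ t, HasDerivAt F (f t) t) (hF0 : ∀ t, 0 ≤ F t) {K : ℝ} 
    (hK : ∀ l : ℝ, 1 ≤ l → ∫ z, |w (l • z) - w z| ≤ K * (l - 1)) {ε l : ℝ} (hε : 0 < ε)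
    (hl : 1 < l) (ht : ∀ z ∈ Rect s α,
      |F (w (l • z)) - F (w z) - f (w z) * (w (l • z) - w z)| ≤ ε * |w (l • z) - w z|) :
    (l ^ 2)⁻¹ * (1 + (l - 1) * (s / (1 - s)))⁻¹ * (∫ z in Rect s α, (1 + z.1) * F (w z)) -
        (∫ z in Rect s α, (1 + z.1) * F (w z)) - 2 * ε * K * (l - 1) ≤
      (l ^ 2)⁻¹ * (l ^ p * (1 + (l - 1) * (s / (1 - s))) ^ p) *
        (∫ z in Rect s α, (1 + z.1) * nrm w z ^ p) / p -
        (∫ z in Rect s α, (1 + z.1) * nrm w z ^ p) / p := by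
  set I := ∫ z in Rect s α, (1 + z.1) * nrm w z ^ p with hI
  set J := ∫ z in Rect s α, (1 + z.1) * F (w z) with hJ
  set τ := 1 + (l - 1) * (s / (1 - s)) with hτdef
  have hl0 : 0 < l := by linarith
  have hS : 0 ≤ s / (1 - s) := div_nonneg hs.1.le (by linarith [hs.2])
  have hτ : 1 ≤ τ := by
    have := mul_nonneg (show 0 ≤ l - 1 by linarith) hS
    linarith
  have hτ0 : 0 < τ := by linarith
  set U : Set (ℝ × ℝ) := {z | l • z ∈ Rect s α} with hUdef
  have hU : IsOpen U := (isOpen_Rect s α).preimage (by fun_prop : Continuous fun z : ℝ × ℝ => l • z)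
  have hUR : U ⊆ Rect s α := fun z hz => mem_scale_Rect hl hz
  have hUm := hU.measurableSet
  have hRm := (isOpen_Rect s α).measurableSet
  have hcw := hw.cont
  have hFc : Continuous F := continuous_iff_continuousAt.2 fun t => (hF t).continuousAt
  set v : ℝ × ℝ → ℝ := fun z => w (l • z) with hv
  have hvc : Continuous v := by fun_prop
  have hv0 : ∀ z ∉ U, v z = 0 := fun z hz => hw.zero _ hz
  have hvd : ContDiffOn ℝ 1 v U :=
    hw.cd.comp (contDiff_const_smul l).contDiffOn fun z hz => hz
  have hgeo : ∀ z ∈ U, 1 + l * z.1 ≤ τ * (1 + z.1) ∧ 0 < 1 + z.1 ∧ 0 < 1 + l * z.1 ∧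
      (z.1 < 0 → 1 + z.1 ≤ τ * (1 + l * z.1)) := by
    intro z hz
    have h1 : -s < l * z.1 := hz.1.1
    have h2 : l * z.1 < s := hz.1.2
    obtain ⟨a, b, c⟩ := geom1 hs hl h1 h2
    exact ⟨a, b, c, fun h => geom2 hs hl h1 h⟩
  have hcomp : ∀ z ∈ U, (1 + z.1) * nrm v z ^ p ≤
      l ^ p * τ ^ p * ((1 + (l • z).1) * nrm w (l • z) ^ p) := by
    intro z hz
    obtain ⟨g1, g2, g3, g4⟩ := hgeo z hz
    obtain ⟨d1, d2⟩ := hw.scaled_deriv hz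
    refine grad_compare (a := dx w (l • z)) (b := dy w (l • z)) hp hl hτ g2 g3 g1 g4
      (nrm_nonneg _ _) (nrm_nonneg _ _) ?_ ?_
    · rw [nrm_sq, d1, d2]
    · rw [nrm_sq]; rfl
  -- integrability of the scaled energy
  have hint1 : IntegrableOn (fun z => (1 + (l • z).1) * nrm w (l • z) ^ p) U := by
    have h1 := (integrable_indicator_iff hRm).2 (hw.int_weight hs)
    have h2 := h1.comp_smul (R := l) hl0.ne'
    rw [← integrable_indicator_iff hUm]
    exact h2
  have hint2 : IntegrableOn (fun z => (1 + z.1) * nrm v z ^ p) U := by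
    refine Integrable.mono' (hint1.const_mul (l ^ p * τ ^ p))
      (Measurable.aestronglyMeasurable (by fun_prop)) ?_
    filter_upwards [ae_restrict_mem hUm] with z hz
    rw [Real.norm_of_nonneg (mul_nonneg (hgeo z hz).2.1.le (Real.rpow_nonneg (nrm_nonneg _ _) _))]
    exact hcomp z hz
  have hint3 : IntegrableOn (fun z => nrm v z ^ p) U := by
    refine Integrable.mono' (hint2.const_mul ((1 - s)⁻¹))
      (Measurable.aestronglyMeasurable (by fun_prop)) ?_
    filter_upwards [ae_restrict_mem hUm] with z hz
    have h0 := Real.rpow_nonneg (nrm_nonneg v z) p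
    rw [Real.norm_of_nonneg h0, ← mul_assoc]
    refine le_mul_of_one_le_left h0 ?_
    rw [inv_mul_eq_div, le_div_iff₀ (by linarith [hs.2])]
    linarith [(hUR hz).1.1]
  have htest := hw.test hp hs hf hU hUR hvc hv0 hvd hint3
  have hint4 : IntegrableOn (fun z => (1 + z.1) * ((1 - 1 / p) * nrm w z ^ p + nrm v z ^ p / p)) U := by
    have := (((hw.int_weight hs).mono_set hUR).const_mul (1 - 1 / p)).add (hint2.div_const p)
    refine this.congr (Eventually.of_forall fun z => ?_)
    simp only [Pi.add_apply]
    ring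
  have hp0 : 0 < p := by linarith
  have h1p : 0 ≤ 1 - 1 / p := by
    rw [sub_nonneg, div_le_one hp0]; exact hp.le
  have hA : ∫ z in U, (1 + z.1) * (nrm w z ^ (p - 2) * ip w v z) ≤
      (1 - 1 / p) * I + (l ^ 2)⁻¹ * (l ^ p * τ ^ p) * I / p := by
    calc ∫ z in U, (1 + z.1) * (nrm w z ^ (p - 2) * ip w v z)
        ≤ ∫ z in U, (1 + z.1) * ((1 - 1 / p) * nrm w z ^ p + nrm v z ^ p / p) := by
          refine setIntegral_mono_on ?_ hint4 hUm ?_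
          · refine Integrable.mono' hint4 (Measurable.aestronglyMeasurable (by fun_prop)) ?_
            filter_upwards [ae_restrict_mem hUm] with z hz
            rw [norm_mul, Real.norm_of_nonneg (hgeo z hz).2.1.le]
            exact mul_le_mul_of_nonneg_left (abs_ip_le hp w v z) (hgeo z hz).2.1.le
          · intro z hz
            exact mul_le_mul_of_nonneg_left ((le_abs_self _).trans (abs_ip_le hp w v z))
              (hgeo z hz).2.1.le
      _ = (1 - 1 / p) * (∫ z in U, (1 + z.1) * nrm w z ^ p) +
            (∫ z in U, (1 + z.1) * nrm v z ^ p) / p := by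
          rw [← integral_const_mul, ← integral_div, ← integral_add]
          · refine integral_congr_ae (Eventually.of_forall fun z => ?_)
            simp only
            ring
          · exact ((hw.int_weight hs).mono_set hUR).const_mul _
          · exact hint2.div_const _
      _ ≤ (1 - 1 / p) * I + (l ^ p * τ ^ p * ((l ^ 2)⁻¹ * I)) / p := by
          have i1 : ∫ z in U, (1 + z.1) * nrm w z ^ p ≤ I := by
            refine setIntegral_mono_set (hw.int_weight hs) ?_ (Eventually.of_forall hUR)
            filter_upwards [ae_restrict_mem hRm] with z hz
            exact mul_nonneg (by linarith [hz.1.1, hs.2]) (Real.rpow_nonneg (nrm_nonneg _ _) _)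
          have i2 : ∫ z in U, (1 + z.1) * nrm v z ^ p ≤ l ^ p * τ ^ p * ((l ^ 2)⁻¹ * I) := by
            rw [hI, ← setIntegral_scale hl, ← integral_const_mul]
            exact setIntegral_mono_on hint2 (hint1.const_mul _) hUm hcomp
          gcongr
      _ = _ := by ring
  have hE := hw.energy hp hs hf
  rw [← hI] at hE
  have hwt : ∀ z ∈ Rect s α, 0 ≤ 1 + z.1 ∧ 1 + z.1 ≤ 2 := fun z hz =>
    ⟨by linarith [hz.1.1, hs.2], by linarith [hz.1.2, hs.2]⟩
  have hB : (∫ z in Rect s α, (1 + z.1) * F (v z)) - J - 2 * ε * K * (l - 1) ≤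
      (∫ z in Rect s α, (1 + z.1) * (f (w z) * v z)) - I := by
    have i1 : (∫ z in Rect s α, (1 + z.1) * F (v z)) - J - ∫ z in Rect s α, 2 * ε * |v z - w z| ≤
        (∫ z in Rect s α, (1 + z.1) * (f (w z) * v z)) - I := by
      rw [hE, hJ, ← integral_sub, ← integral_sub, ← integral_sub]
      · refine setIntegral_mono_on ?_ ?_ hRm ?_
        · exact intOn_cont (by fun_prop)
        · exact intOn_cont (by fun_prop)
        · intro z hz
          have h1 := (abs_le.1 (ht z hz)).2
          obtain ⟨h2, h3⟩ := hwt z hz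
          have h4 : (1 + z.1) * (ε * |v z - w z|) ≤ 2 * (ε * |v z - w z|) := by gcongr
          have h5 : (1 + z.1) * (F (v z) - F (w z) - f (w z) * (v z - w z)) ≤
            (1 + z.1) * (ε * |v z - w z|) := mul_le_mul_of_nonneg_left h1 h2
          linarith
      all_goals exact intOn_cont (by fun_prop)
    have i2 : ∫ z in Rect s α, 2 * ε * |v z - w z| ≤ 2 * ε * K * (l - 1) := by
      rw [integral_const_mul, mul_assoc (2 * ε)]
      refine mul_le_mul_of_nonneg_left (le_trans ?_ (hK l hl.le)) (by positivity)
      refine setIntegral_le_integral ?_ (Eventually.of_forall fun z => abs_nonneg _)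
      have hcs := hw.compactSupport
      have hcs2 : HasCompactSupport v := hcs.comp_smul hl0.ne'
      refine Integrable.abs ?_
      exact (hvc.integrable_of_hasCompactSupport hcs2).sub (hcw.integrable_of_hasCompactSupport hcs)
    linarith
  have hCF : (l ^ 2)⁻¹ * τ⁻¹ * J ≤ ∫ z in Rect s α, (1 + z.1) * F (v z) := by
    have hintF : IntegrableOn (fun z => (1 + z.1) * F (v z)) (Rect s α) :=
      intOn_cont (by fun_prop)
    calc (l ^ 2)⁻¹ * τ⁻¹ * J = ∫ z in U, τ⁻¹ * ((1 + (l • z).1) * F (w (l • z))) := by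
          rw [integral_const_mul, setIntegral_scale hl (fun z => (1 + z.1) * F (w z)), ← hJ]; ring
      _ ≤ ∫ z in U, (1 + z.1) * F (v z) := by
          refine setIntegral_mono_on ?_ (hintF.mono_set hUR) hUm ?_
          · refine IntegrableOn.mono_set (t := Rect s α) ?_ hUR
            exact intOn_cont (by fun_prop)
          · intro z hz
            have g1 := (hgeo z hz).1
            rw [inv_mul_eq_div, div_le_iff₀ hτ0]
            have : (1 + (l • z).1) * F (w (l • z)) ≤ τ * (1 + z.1) * F (w (l • z)) :=
              mul_le_mul_of_nonneg_right g1 (hF0 _)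
            simp only [hv]
            linarith
      _ ≤ _ := by
          refine setIntegral_mono_set hintF ?_ (Eventually.of_forall hUR)
          filter_upwards [ae_restrict_mem hRm] with z hz
          exact mul_nonneg (hwt z hz).1 (hF0 _)
  rw [htest] at hA
  have : (1 - 1 / p) * I = I - I / p := by ring
  linarith

/-- The key inequality in polar coordinates. -/
lemma Core.main (hw : Core p s α f w) (hp : 1 < p) (hs : s ∈ Ioo (0:ℝ) 1) (hf : Continuous f)
    (hF : ∀ t, HasDerivAt F (f t) t) {q : ℝ} (hq : 0 < q)
    (hqF : ∀ t : ℝ, q * F t ≤ t * f t ∧ 0 ≤ q * F t) :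
    0 ≤ (1 - 2 / p + 2 / q + (1 + 1 / p + 1 / q) * (s / (1 - s))) *
        ∫ z in Rect s α, (1 + z.1) * nrm w z ^ p := by
  have hF0 : ∀ t, 0 ≤ F t := fun t => nonneg_of_mul_nonneg_right (hqF t).2 hq
  have hFc : Continuous F := continuous_iff_continuousAt.2 fun t => (hF t).continuousAt
  obtain ⟨K, hK0, hK⟩ := hw.L1 hp hs
  have hcw := hw.cont
  have hRm := (isOpen_Rect s α).measurableSet
  have hS : 0 ≤ s / (1 - s) := div_nonneg hs.1.le (by linarith [hs.2])
  have hE := hw.energy hp hs hf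
  have hmain : ∀ ε > 0, 0 ≤ (1 - 2 / p + s / (1 - s)) * (∫ z in Rect s α, (1 + z.1) * nrm w z ^ p) +
      (2 + s / (1 - s)) * (∫ z in Rect s α, (1 + z.1) * F (w z)) + 2 * ε * K := by
    intro ε hε
    refine numeric_limit hp ?_
    filter_upwards [hw.taylor hf hF hε, self_mem_nhdsWithin] with l hl hl1
    exact hw.step hp hs hf hF hF0 hK hε hl1 hl
  have hqJ : q * (∫ z in Rect s α, (1 + z.1) * F (w z)) ≤
      ∫ z in Rect s α, (1 + z.1) * nrm w z ^ p := by
    rw [hE, ← integral_const_mul]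
    refine setIntegral_mono_on (intOn_cont (by fun_prop)) (intOn_cont (by fun_prop)) hRm ?_
    intro z hz
    have h1 : 0 ≤ 1 + z.1 := by linarith [hz.1.1, hs.2]
    have := mul_le_mul_of_nonneg_left (hqF (w z)).1 h1
    linarith
  have hI0 : 0 ≤ ∫ z in Rect s α, (1 + z.1) * nrm w z ^ p := by
    refine setIntegral_nonneg hRm fun z hz => ?_
    exact mul_nonneg (by linarith [hz.1.1, hs.2]) (Real.rpow_nonneg (nrm_nonneg _ _) _)
  set I := ∫ z in Rect s α, (1 + z.1) * nrm w z ^ p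
  set J := ∫ z in Rect s α, (1 + z.1) * F (w z)
  set S := s / (1 - s)
  have h0 : 0 ≤ (1 - 2 / p + S) * I + (2 + S) * J := by
    refine le_of_forall_pos_le_add fun δ hδ => ?_
    have := hmain (δ / (2 * (K + 1))) (by positivity)
    refine this.trans ?_
    have : 2 * (δ / (2 * (K + 1))) * K ≤ δ := by
      rw [show 2 * (δ / (2 * (K + 1))) * K = δ * (K / (K + 1)) by field_simp]
      exact mul_le_of_le_one_right hδ.le (by rw [div_le_one (by positivity)]; linarith)
    linarith
  have h1 : J ≤ I / q := by rw [le_div_iff₀ hq]; linarith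
  have h2 : (2 + S) * J ≤ (2 + S) * (I / q) := by gcongr
  have h3 : 0 ≤ 1 / p * S * I := by positivity
  have h4 : (1 - 2 / p + 2 / q + (1 + 1 / p + 1 / q) * S) * I =
    (1 - 2 / p + S) * I + (2 + S) * (I / q) + 1 / p * S * I := by ring
  linarith
end

end

section
open Set Filter Topology

/-- Shifted polar coordinates. -/
def pol (z : ℝ × ℝ) : ℂ := ((1 + z.1 : ℝ) : ℂ) * Complex.exp ((z.2 : ℂ) * Complex.I)

lemma pol_eq (z : ℝ × ℝ) : pol z = Complex.polarCoord.symm (1 + z.1, z.2) := by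
  rw [Complex.polarCoord_symm_apply, pol, Complex.exp_mul_I]
  simp

lemma Omega2_eq (α s : ℝ) :
    Omega2 α s = Complex.polarCoord.symm '' (Ioo (1 - s) (1 + s) ×ˢ Ioo (-α) α) := by
  ext z
  simp only [Omega2, mem_ofPred_eq, mem_image, Prod.exists, mem_prod, mem_Ioo,
    Complex.polarCoord_symm_apply, Complex.exp_mul_I]
  constructor
  · rintro ⟨ρ, θ, h1, h2, rfl⟩
    rw [abs_lt] at h1 h2
    exact ⟨ρ, θ, ⟨⟨by linarith, by linarith⟩, h1⟩, by simp⟩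
  · rintro ⟨ρ, θ, ⟨⟨h1, h2⟩, h3⟩, rfl⟩
    exact ⟨ρ, θ, abs_lt.2 h3, abs_lt.2 ⟨by linarith, by linarith⟩, by simp⟩

lemma sub_target {α s : ℝ} (hα : α ∈ Ioo 0 π) (hs : s ∈ Ioo (0:ℝ) 1) :
    (Ioo (1 - s) (1 + s) ×ˢ Ioo (-α) α) ⊆ Complex.polarCoord.target := by
  rintro ⟨r, t⟩ ⟨⟨h1, h2⟩, h3, h4⟩
  rw [Complex.polarCoord_target]
  simp only at h1 h2 h3 h4
  exact ⟨by simp only [mem_Ioi]; linarith [hs.2], by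
    simp only [mem_Ioo]; constructor <;> linarith [hα.2]⟩

lemma isOpen_Omega2 {α s : ℝ} (hα : α ∈ Ioo 0 π) (hs : s ∈ Ioo (0:ℝ) 1) :
    IsOpen (Omega2 α s) := by
  rw [Omega2_eq]
  exact Complex.polarCoord.isOpen_image_symm_of_subset_target (isOpen_Ioo.prod isOpen_Ioo)
    (sub_target hα hs)

lemma mem_Omega2 {α s : ℝ} (hα : α ∈ Ioo 0 π) (hs : s ∈ Ioo (0:ℝ) 1) {z : ℝ × ℝ}
    (hz : z ∈ Complex.polarCoord.target) :
    Complex.polarCoord.symm z ∈ Omega2 α s ↔ z ∈ Ioo (1 - s) (1 + s) ×ˢ Ioo (-α) α := by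
  rw [Omega2_eq]
  constructor
  · rintro ⟨y, hy, h⟩
    rwa [← Complex.polarCoord.symm.injOn (sub_target hα hs hy) hz h]
  · exact mem_image_of_mem _

lemma shift_mem {α s : ℝ} (z : ℝ × ℝ) :
    (1 + z.1, z.2) ∈ Ioo (1 - s) (1 + s) ×ˢ Ioo (-α) α ↔ z ∈ Rect s α := by
  simp only [Rect, mem_prod, mem_Ioo]
  constructor <;> rintro ⟨⟨h1, h2⟩, h3⟩ <;> exact ⟨⟨by linarith, by linarith⟩, h3⟩

lemma pol_mem {α s : ℝ} (hα : α ∈ Ioo 0 π) (hs : s ∈ Ioo (0:ℝ) 1) {z : ℝ × ℝ}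
    (hz : z ∈ Rect s α) : pol z ∈ Omega2 α s := by
  rw [pol_eq, mem_Omega2 hα hs (sub_target hα hs ((shift_mem z).2 hz))]
  exact (shift_mem z).2 hz

lemma continuous_pol : Continuous pol := by
  unfold pol; fun_prop

lemma contDiff_pol : ContDiff ℝ 1 pol := by
  unfold pol
  have h1 : ContDiff ℝ 1 (fun z : ℝ × ℝ => ((1 + z.1 : ℝ) : ℂ)) :=
    Complex.ofRealCLM.contDiff.comp (contDiff_const.add contDiff_fst)
  have h2 : ContDiff ℝ 1 (fun z : ℝ × ℝ => (z.2 : ℂ)) :=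
    Complex.ofRealCLM.contDiff.comp contDiff_snd
  exact h1.mul (Complex.contDiff_exp.comp (h2.mul contDiff_const))

lemma pol_frontier {α s : ℝ} (hα : α ∈ Ioo 0 π) (hs : s ∈ Ioo (0:ℝ) 1) {z : ℝ × ℝ}
    (hz : z ∈ frontier (Rect s α)) : pol z ∈ frontier (Omega2 α s) := by
  rw [(isOpen_Rect s α).frontier_eq] at hz
  rw [(isOpen_Omega2 hα hs).frontier_eq]
  refine ⟨?_, ?_⟩
  · exact map_mem_closure continuous_pol hz.1 (fun z hz => pol_mem hα hs hz)
  · have hc : closure (Rect s α) ⊆ Icc (-s) s ×ˢ Icc (-α) α :=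
      closure_minimal (prod_mono Ioo_subset_Icc_self Ioo_subset_Icc_self)
        (isClosed_Icc.prod isClosed_Icc)
    obtain ⟨⟨h1, h2⟩, h3, h4⟩ := hc hz.1
    have ht : (1 + z.1, z.2) ∈ Complex.polarCoord.target := by
      rw [Complex.polarCoord_target]
      exact ⟨by simp only [mem_Ioi]; linarith [hs.2], by
        simp only [mem_Ioo]; constructor <;> linarith [hα.2]⟩
    rw [pol_eq, mem_Omega2 hα hs ht, shift_mem]
    exact hz.2

lemma chg_set {α s : ℝ} (hα : α ∈ Ioo 0 π) (hs : s ∈ Ioo (0:ℝ) 1) (g : ℂ → ℝ) :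
    ∫ z in Omega2 α s, g z = ∫ z in Rect s α, (1 + z.1) * g (pol z) := by
  have hm := (isOpen_Omega2 hα hs).measurableSet
  rw [← integral_indicator hm, ← Complex.integral_comp_polarCoord_symm]
  have e1 : ∫ p in polarCoord.target, p.1 • (Omega2 α s).indicator g (Complex.polarCoord.symm p)
      = ∫ p in polarCoord.target, (Ioo (1 - s) (1 + s) ×ˢ Ioo (-α) α).indicator
        (fun p => p.1 * g (Complex.polarCoord.symm p)) p := by
    apply setIntegral_congr_fun polarCoord.open_target.measurableSet
    intro p hp
    have := mem_Omega2 hα hs (z := p) hp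
    by_cases h : p ∈ Ioo (1 - s) (1 + s) ×ˢ Ioo (-α) α
    · simp only [indicator_of_mem h, indicator_of_mem (this.2 h), smul_eq_mul]
    · simp only [indicator_of_notMem h, indicator_of_notMem (mt this.1 h), smul_zero]
  have hm2 : MeasurableSet (Ioo (1 - s) (1 + s) ×ˢ Ioo (-α) α) :=
    measurableSet_Ioo.prod measurableSet_Ioo
  have hsub : (Ioo (1 - s) (1 + s) ×ˢ Ioo (-α) α) ⊆ polarCoord.target := sub_target hα hs
  rw [e1, setIntegral_indicator hm2, inter_eq_right.2 hsub]
  have mp := measurePreserving_add_left (volume : Measure (ℝ × ℝ)) ((1:ℝ), (0:ℝ))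
  rw [← mp.setIntegral_preimage_emb (MeasurableEquiv.addLeft _).measurableEmbedding]
  have : (fun x : ℝ × ℝ => ((1:ℝ), (0:ℝ)) + x) ⁻¹' (Ioo (1 - s) (1 + s) ×ˢ Ioo (-α) α)
      = Rect s α := by
    ext z
    rw [← shift_mem (α := α) (s := s) z]
    simp
  rw [this]
  congr 1
  ext z
  rw [pol_eq]; simp

lemma chg_lset {α s : ℝ} (hα : α ∈ Ioo 0 π) (hs : s ∈ Ioo (0:ℝ) 1) (g : ℂ → ENNReal) :
    ∫⁻ z in Omega2 α s, g z = ∫⁻ z in Rect s α, ENNReal.ofReal (1 + z.1) * g (pol z) := by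
  have hm := (isOpen_Omega2 hα hs).measurableSet
  rw [← lintegral_indicator hm, ← Complex.lintegral_comp_polarCoord_symm]
  have e1 : ∫⁻ p in polarCoord.target,
        ENNReal.ofReal p.1 • (Omega2 α s).indicator g (Complex.polarCoord.symm p)
      = ∫⁻ p in polarCoord.target, (Ioo (1 - s) (1 + s) ×ˢ Ioo (-α) α).indicator
        (fun p => ENNReal.ofReal p.1 * g (Complex.polarCoord.symm p)) p := by
    apply setLIntegral_congr_fun polarCoord.open_target.measurableSet
    intro p hp
    have := mem_Omega2 hα hs (z := p) hp
    by_cases h : p ∈ Ioo (1 - s) (1 + s) ×ˢ Ioo (-α) α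
    · simp only [indicator_of_mem h, indicator_of_mem (this.2 h), smul_eq_mul]
    · simp only [indicator_of_notMem h, indicator_of_notMem (mt this.1 h), smul_zero]
  have hm2 : MeasurableSet (Ioo (1 - s) (1 + s) ×ˢ Ioo (-α) α) :=
    measurableSet_Ioo.prod measurableSet_Ioo
  have hsub : (Ioo (1 - s) (1 + s) ×ˢ Ioo (-α) α) ⊆ polarCoord.target := sub_target hα hs
  rw [e1, setLIntegral_indicator hm2, inter_eq_left.2 hsub]
  have mp := measurePreserving_add_left (volume : Measure (ℝ × ℝ)) ((1:ℝ), (0:ℝ))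
  rw [← mp.setLIntegral_comp_preimage_emb (MeasurableEquiv.addLeft _).measurableEmbedding]
  have : (fun x : ℝ × ℝ => ((1:ℝ), (0:ℝ)) + x) ⁻¹' (Ioo (1 - s) (1 + s) ×ˢ Ioo (-α) α)
      = Rect s α := by
    ext z
    rw [← shift_mem (α := α) (s := s) z]
    simp
  rw [this]
  congr 1
  ext z
  rw [pol_eq]; simp

lemma pol_fderiv (z : ℝ × ℝ) : ∃ L : ℝ × ℝ →L[ℝ] ℂ, HasFDerivAt pol L z ∧
    L (1, 0) = Complex.exp (z.2 * Complex.I) ∧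
    L (0, 1) = ((1 + z.1 : ℝ) : ℂ) * (Complex.I * Complex.exp (z.2 * Complex.I)) := by
  have h1 : HasFDerivAt (fun z : ℝ × ℝ => ((1 + z.1 : ℝ) : ℂ))
      (Complex.ofRealCLM.comp (ContinuousLinearMap.fst ℝ ℝ ℝ)) z :=
    Complex.ofRealCLM.hasFDerivAt.comp z (hasFDerivAt_fst.const_add 1)
  have h2 : HasFDerivAt (fun z : ℝ × ℝ => (z.2 : ℂ))
      (Complex.ofRealCLM.comp (ContinuousLinearMap.snd ℝ ℝ ℝ)) z :=
    Complex.ofRealCLM.hasFDerivAt.comp z hasFDerivAt_snd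
  refine ⟨_, h1.mul ((h2.mul_const Complex.I).cexp), ?_, ?_⟩
  · simp
  · simp
    left; ring

end

section
open Set Filter Topology

lemma integrable_prod_supp {R : Set (ℝ × ℝ)} {B g : ℝ × ℝ → ℝ}
    (hB : ContinuousOn B R) (hg : Continuous g) (hc : HasCompactSupport g)
    (hs : tsupport g ⊆ R) : Integrable (fun z => B z * g z) := by
  have h : IntegrableOn (fun z => B z * g z) (tsupport g) :=
    ((hB.mono hs).mul hg.continuousOn).integrableOn_compact hc
  refine (integrableOn_iff_integrable_of_support_subset ?_).1 h
  exact (Function.support_mul_subset_right _ _).trans (subset_tsupport _)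

lemma ibp_open {R : Set (ℝ × ℝ)} (hR : IsOpen R) {B φ : ℝ × ℝ → ℝ} (v : ℝ × ℝ)
    (hB : ContDiffOn ℝ 1 B R) (hφ : ContDiff ℝ 1 φ) (hc : HasCompactSupport φ)
    (hs : tsupport φ ⊆ R) :
    IntegrableOn (fun z => B z * fderiv ℝ φ z v) R ∧
    IntegrableOn (fun z => fderiv ℝ B z v * φ z) R ∧
    ∫ z in R, B z * fderiv ℝ φ z v = - ∫ z in R, fderiv ℝ B z v * φ z := by
  have hdφ : Continuous (fun z => fderiv ℝ φ z v) :=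
    (hφ.continuous_fderiv one_ne_zero).clm_apply continuous_const
  have hsup : tsupport (fun z => fderiv ℝ φ z v) ⊆ tsupport φ := by
    refine closure_minimal ?_ (isClosed_tsupport φ)
    intro z hz
    apply support_fderiv_subset ℝ (f := φ)
    intro h
    apply hz
    simp [h]
  have hcd : HasCompactSupport (fun z => fderiv ℝ φ z v) :=
    hc.of_isClosed_subset (isClosed_tsupport _) hsup
  have hdB : ContinuousOn (fun z => fderiv ℝ B z v) R :=
    (hB.continuousOn_fderiv_of_isOpen hR le_rfl).clm_apply continuousOn_const
  have i1 := integrable_prod_supp hB.continuousOn hdφ hcd (hsup.trans hs)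
  have i2 := integrable_prod_supp hdB hφ.continuous hc hs
  have i3 := integrable_prod_supp hB.continuousOn hφ.continuous hc hs
  have z0 : ∀ z, z ∉ R → φ z = 0 := fun z hz =>
    image_eq_zero_of_notMem_tsupport (fun h => hz (hs h))
  have z1 : ∀ z, z ∉ R → fderiv ℝ φ z v = 0 := fun z hz =>
    image_eq_zero_of_notMem_tsupport (f := fun z => fderiv ℝ φ z v)
      (fun h => hz (hs (hsup h)))
  refine ⟨i1.integrableOn, i2.integrableOn, ?_⟩
  rw [setIntegral_eq_integral_of_forall_compl_eq_zero (fun z hz => by simp [z1 z hz]),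
    setIntegral_eq_integral_of_forall_compl_eq_zero (fun z hz => by simp [z0 z hz])]
  exact integral_mul_fderiv_eq_neg_fderiv_mul_of_integrable i2 i1 i3
    (fun z hz => (hB.differentiableOn one_ne_zero).differentiableAt (hR.mem_nhds (hs hz)))
    (fun z _ => hφ.differentiable one_ne_zero z)

lemma clm_decomp {E : Type*} [NormedAddCommGroup E] [NormedSpace ℝ E] (D : ℂ →L[ℝ] E) (v : ℂ) :
    D v = v.re • D 1 + v.im • D Complex.I := by
  rw [← D.map_smul, ← D.map_smul, ← D.map_add]
  congr 1
  apply Complex.ext <;> simp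

/-- The solution in polar coordinates, extended by zero. -/
def polW (α s : ℝ) (u : ℂ → ℝ) : ℝ × ℝ → ℝ := (Rect s α).indicator (u ∘ pol)

section
variable {p α s : ℝ} {f : ℝ → ℝ} {u : ℂ → ℝ}

lemma polW_fderiv (hα : α ∈ Ioo 0 π) (hs : s ∈ Ioo (0:ℝ) 1)
    (hu : ContDiffOn ℝ 1 u (Omega2 α s)) {z : ℝ × ℝ} (hz : z ∈ Rect s α) :
    dx (polW α s u) z = (grad u (pol z)).re * cos z.2 + (grad u (pol z)).im * sin z.2 ∧
    dy (polW α s u) z =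
      (1 + z.1) * (-(grad u (pol z)).re * sin z.2 + (grad u (pol z)).im * cos z.2) := by
  obtain ⟨L, hL, h1, h2⟩ := pol_fderiv z
  have hd : DifferentiableAt ℝ u (pol z) :=
    (hu.differentiableOn one_ne_zero).differentiableAt
      ((isOpen_Omega2 hα hs).mem_nhds (pol_mem hα hs hz))
  have he : polW α s u =ᶠ[𝓝 z] u ∘ pol := by
    filter_upwards [(isOpen_Rect s α).mem_nhds hz] with y hy
    exact indicator_of_mem hy _
  have hf : fderiv ℝ (polW α s u) z = (fderiv ℝ u (pol z)).comp L := by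
    rw [he.fderiv_eq]
    exact (hd.hasFDerivAt.comp z hL).fderiv
  unfold dx dy grad
  rw [hf]
  simp only [ContinuousLinearMap.comp_apply, h1, h2]
  rw [clm_decomp _ (Complex.exp _), clm_decomp _ (_ * _)]
  simp only [Complex.re_ofReal_mul, Complex.im_ofReal_mul, Complex.I_mul_re, Complex.I_mul_im,
    Complex.exp_ofReal_mul_I_re, Complex.exp_ofReal_mul_I_im, smul_eq_mul]
  constructor <;> ring

lemma Rect_pos (hs : s ∈ Ioo (0:ℝ) 1) {z : ℝ × ℝ} (hz : z ∈ Rect s α) : 0 < 1 + z.1 := by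
  have := hz.1.1
  linarith [hs.2]

lemma polW_nrm (hα : α ∈ Ioo 0 π) (hs : s ∈ Ioo (0:ℝ) 1)
    (hu : ContDiffOn ℝ 1 u (Omega2 α s)) {z : ℝ × ℝ} (hz : z ∈ Rect s α) :
    nrm (polW α s u) z = ‖grad u (pol z)‖ := by
  obtain ⟨h1, h2⟩ := polW_fderiv hα hs hu hz
  have hm := (Rect_pos hs hz).ne'
  rw [nrm, h1, h2, mul_div_cancel_left₀ _ hm, Complex.norm_eq_sqrt_sq_add_sq]
  congr 1
  linear_combination ((grad u (pol z)).re ^ 2 + (grad u (pol z)).im ^ 2) * sin_sq_add_cos_sq z.2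

lemma polW_div (hα : α ∈ Ioo 0 π) (hs : s ∈ Ioo (0:ℝ) 1) {A : ℂ → ℂ}
    (hA : ContDiffOn ℝ 1 A (Omega2 α s)) :
    ContDiffOn ℝ 1 (fun z : ℝ × ℝ => (1 + z.1) *
      ((A (pol z)).re * cos z.2 + (A (pol z)).im * sin z.2)) (Rect s α) ∧
    ContDiffOn ℝ 1 (fun z : ℝ × ℝ =>
      (-(A (pol z)).re * sin z.2 + (A (pol z)).im * cos z.2)) (Rect s α) ∧
    ∀ z ∈ Rect s α,
      fderiv ℝ (fun z : ℝ × ℝ => (1 + z.1) *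
        ((A (pol z)).re * cos z.2 + (A (pol z)).im * sin z.2)) z (1, 0) +
      fderiv ℝ (fun z : ℝ × ℝ =>
        (-(A (pol z)).re * sin z.2 + (A (pol z)).im * cos z.2)) z (0, 1)
      = (1 + z.1) * divg A (pol z) := by
  have hAp : ContDiffOn ℝ 1 (fun z => A (pol z)) (Rect s α) :=
    hA.comp contDiff_pol.contDiffOn (fun z hz => pol_mem hα hs hz)
  have hre : ContDiffOn ℝ 1 (fun z => (A (pol z)).re) (Rect s α) :=
    Complex.reCLM.contDiff.comp_contDiffOn hAp
  have him : ContDiffOn ℝ 1 (fun z => (A (pol z)).im) (Rect s α) :=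
    Complex.imCLM.contDiff.comp_contDiffOn hAp
  have hc : ContDiffOn ℝ 1 (fun z : ℝ × ℝ => cos z.2) (Rect s α) :=
    (contDiff_cos.comp contDiff_snd).contDiffOn
  have hsn : ContDiffOn ℝ 1 (fun z : ℝ × ℝ => sin z.2) (Rect s α) :=
    (contDiff_sin.comp contDiff_snd).contDiffOn
  have hm : ContDiffOn ℝ 1 (fun z : ℝ × ℝ => 1 + z.1) (Rect s α) :=
    (contDiff_const.add contDiff_fst).contDiffOn
  refine ⟨hm.mul ((hre.mul hc).add (him.mul hsn)), (hre.neg.mul hsn).add (him.mul hc), ?_⟩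
  intro z hz
  obtain ⟨L, hL, h1, h2⟩ := pol_fderiv z
  have hd : DifferentiableAt ℝ A (pol z) :=
    (hA.differentiableOn one_ne_zero).differentiableAt
      ((isOpen_Omega2 hα hs).mem_nhds (pol_mem hα hs hz))
  have dAp : HasFDerivAt (fun z => A (pol z)) ((fderiv ℝ A (pol z)).comp L) z :=
    hd.hasFDerivAt.comp z hL
  have dre : HasFDerivAt (fun z => (A (pol z)).re)
      (Complex.reCLM.comp ((fderiv ℝ A (pol z)).comp L)) z :=
    Complex.reCLM.hasFDerivAt.comp z dAp
  have dim : HasFDerivAt (fun z => (A (pol z)).im)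
      (Complex.imCLM.comp ((fderiv ℝ A (pol z)).comp L)) z :=
    Complex.imCLM.hasFDerivAt.comp z dAp
  have dsnd : HasFDerivAt (fun z : ℝ × ℝ => z.2) (ContinuousLinearMap.snd ℝ ℝ ℝ) z :=
    hasFDerivAt_snd
  have dfst : HasFDerivAt (fun z : ℝ × ℝ => 1 + z.1) (ContinuousLinearMap.fst ℝ ℝ ℝ) z :=
    hasFDerivAt_fst.const_add 1
  have F1 := dfst.mul ((dre.mul dsnd.cos).add (dim.mul dsnd.sin))
  have F2 := (dre.neg.mul dsnd.sin).add (dim.mul dsnd.cos)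
  have e1 : fderiv ℝ (fun z : ℝ × ℝ => (1 + z.1) *
        ((A (pol z)).re * cos z.2 + (A (pol z)).im * sin z.2)) z = _ := F1.fderiv
  have e2 : fderiv ℝ (fun z : ℝ × ℝ =>
        (-(A (pol z)).re * sin z.2 + (A (pol z)).im * cos z.2)) z = _ := F2.fderiv
  rw [e1, e2]
  simp only [_root_.add_apply, _root_.smul_apply, _root_.neg_apply,
    ContinuousLinearMap.comp_apply, h1, h2, Complex.reCLM_apply, Complex.imCLM_apply,
    ContinuousLinearMap.coe_snd', ContinuousLinearMap.coe_fst', smul_eq_mul]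
  rw [clm_decomp _ (Complex.exp _), clm_decomp _ (_ * _)]
  simp only [Complex.re_ofReal_mul, Complex.im_ofReal_mul, Complex.I_mul_re, Complex.I_mul_im,
    Complex.exp_ofReal_mul_I_re, Complex.exp_ofReal_mul_I_im, Complex.add_re, Complex.add_im,
    Complex.smul_re, Complex.smul_im, smul_eq_mul, divg, Pi.neg_apply, Pi.add_apply, Pi.mul_apply]
  linear_combination ((1 + z.1) * ((fderiv ℝ A (pol z) 1).re +
    (fderiv ℝ A (pol z) Complex.I).im)) * sin_sq_add_cos_sq z.2

lemma polW_core (hp : 1 < p) (hα : α ∈ Ioo 0 π) (hs : s ∈ Ioo (0:ℝ) 1)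
    (hu : IsClassicalSolution p f (Omega2 α s) u) : Core p s α f (polW α s u) where
  cont := by
    apply continuous_indicator
    · intro z hz
      exact hu.boundary _ (pol_frontier hα hs hz)
    · refine hu.contOn.comp continuous_pol.continuousOn ?_
      intro z hz
      exact map_mem_closure continuous_pol hz (fun z hz => pol_mem hα hs hz)
  zero := fun z hz => indicator_of_notMem hz _
  cd := by
    refine ContDiffOn.congr (f := u ∘ pol) ?_ (fun z hz => indicator_of_mem hz _)
    exact hu.contDiffOn.comp contDiff_pol.contDiffOn (fun z hz => pol_mem hα hs hz)
  weak := by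
    intro φ hφ hc hsφ
    obtain ⟨c1, c2, hdiv⟩ := polW_div hα hs hu.fieldContDiffOn
    obtain ⟨i1, j1, k1⟩ := ibp_open (isOpen_Rect s α) (1, 0) c1 hφ hc hsφ
    obtain ⟨i2, j2, k2⟩ := ibp_open (isOpen_Rect s α) (0, 1) c2 hφ hc hsφ
    have hm := (isOpen_Rect s α).measurableSet
    have K := congrArg₂ (fun a b : ℝ => a + b) k1 k2
    rw [← integral_add i1 i2, ← neg_add, ← integral_add j1 j2, ← integral_neg] at K
    refine Eq.trans ?_ (K.trans ?_)
    rotate_left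
    · apply setIntegral_congr_fun hm
      intro z hz
      have h := hdiv z hz
      have h' := hu.pde _ (pol_mem hα hs hz)
      have hw : polW α s u z = u (pol z) := indicator_of_mem hz _
      simp only [hw]
      rw [← add_mul, h]
      linear_combination (-(1 + z.1) * φ z) * h'
    · apply setIntegral_congr_fun hm
      intro z hz
      obtain ⟨h1, h2⟩ := polW_fderiv hα hs hu.contDiffOn hz
      have hm := (Rect_pos hs hz).ne'
      simp only [ip]
      rw [polW_nrm hα hs hu.contDiffOn hz, h1, h2]
      simp only [Complex.smul_re, Complex.smul_im, smul_eq_mul, dx, dy]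
      field_simp
  int := by
    have hm := (isOpen_Rect s α).measurableSet
    have key : ∫⁻ z in Rect s α, ENNReal.ofReal (nrm (polW α s u) z ^ p) < ⊤ := by
      have hfin : ∫⁻ z in Omega2 α s, ENNReal.ofReal (‖grad u z‖ ^ p) < ⊤ := by
        have := hu.integrable.hasFiniteIntegral
        rw [hasFiniteIntegral_iff_ofReal (Eventually.of_forall fun z => by positivity)] at this
        exact this
      rw [chg_lset hα hs] at hfin
      have hle : ENNReal.ofReal (1 - s) * ∫⁻ z in Rect s α, ENNReal.ofReal (nrm (polW α s u) z ^ p)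
          ≤ ∫⁻ z in Rect s α, ENNReal.ofReal (1 + z.1) * ENNReal.ofReal (‖grad u (pol z)‖ ^ p) := by
        rw [← lintegral_const_mul' _ _ ENNReal.ofReal_ne_top]
        apply setLIntegral_mono' hm
        intro z hz
        rw [polW_nrm hα hs hu.contDiffOn hz]
        gcongr
        have := hz.1.1
        linarith
      have h1 := hle.trans_lt hfin
      refine ENNReal.lt_top_of_mul_ne_top_right h1.ne ?_
      simpa using hs.2
    refine ⟨((measurable_nrm _).pow_const p).aestronglyMeasurable, ?_⟩
    rw [hasFiniteIntegral_iff_ofReal (Eventually.of_forall fun z => by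
      unfold nrm; positivity)]
    exact key

end
end

theorem key_inequality (p : ℝ) (hp1 : 1 < p) (hp2 : p < 2)
    (α : ℝ) (hα : α ∈ Set.Ioo (0:ℝ) π) (s : ℝ) (hs : s ∈ Set.Ioo (0:ℝ) 1)
    (f F : ℝ → ℝ) (hf : Continuous f)
    (hF : ∀ t : ℝ, F t = ∫ τ in (0:ℝ)..t, f τ)
    (q : ℝ) (hq : 2 * p / (2 - p) < q)
    (hqF : ∀ t : ℝ, q * F t ≤ t * f t ∧ 0 ≤ q * F t)
    (u : ℂ → ℝ) (hu : IsClassicalSolution p f (Omega2 α s) u) :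
    0 ≤ (1 - 2 / p + 2 / q + (1 + 1 / p + 1 / q) * (s / (1 - s))) *
        ∫ z in Omega2 α s, ‖grad u z‖ ^ p := by
  have hq0 : 0 < q := lt_trans (div_pos (by linarith) (by linarith)) hq
  have hF' : ∀ t, HasDerivAt F (f t) t := by
    intro t
    rw [funext hF]
    exact intervalIntegral.integral_hasDerivAt_right (hf.intervalIntegrable _ _)
      (hf.stronglyMeasurableAtFilter _ _) hf.continuousAt
  have hw := polW_core hp1 hα hs hu
  have h := hw.main hp1 hs hf hF' hq0 hqF
  rw [chg_set hα hs]
  convert h using 2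
  apply setIntegral_congr_fun (isOpen_Rect s α).measurableSet
  intro z hz
  simp only
  rw [polW_nrm hα hs hu.contDiffOn hz]
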